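/- The class TKR∀ (knowledge bases all of whose restricted chase sequences are finite) is Π¹₁-hard: every Π¹₁ problem many-one reduces to membership in TKR∀. -/

import Mathlib

/-!
Common formalization framework for "Restricted Chase Termination: You Want More than Fairness"
(Carral, Gerlach, Larroque, Thomazo).

Syntax is encoded over natural numbers so that all finite objects (rules, databases, knowledge
bases, Turing machines) live in `Primcodable` types, which allows us to speak about
many-one reductions and about the arithmetical/analytical hierarchy.
-/

namespace ChaseTermination

/-! ### Terms, atoms, facts, rules, knowledge bases -/

/-- Ground terms: `Sum.inl c` is the constant `c`, `Sum.inr n` is the null `n`. -/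
abbrev GroundTerm : Type := ℕ ⊕ ℕ

/-- Terms of rules: `Sum.inl v` is the variable `v`, `Sum.inr g` a ground term. -/
abbrev RTerm : Type := ℕ ⊕ GroundTerm

/-- A fact: a predicate (coded by a natural number) applied to ground terms. -/
abbrev Fact : Type := ℕ × List GroundTerm

/-- An atom: a predicate applied to terms. -/
abbrev Atom : Type := ℕ × List RTerm

/-- An existential rule, given by its body and its head (lists of atoms);
the universally quantified variables are those occurring in the body, the existentially
quantified ones are the head variables not occurring in the body. -/
abbrev Rule : Type := List Atom × List Atom

abbrev RuleSet : Type := List Rule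

abbrev Database : Type := List Fact

/-- A knowledge base: a (finite) rule set together with a database. -/
abbrev KB : Type := RuleSet × Database

def atomHasVar (a : Atom) (v : ℕ) : Prop := (Sum.inl v : RTerm) ∈ a.2

def atomNullFree (a : Atom) : Prop := ∀ t ∈ a.2, ∀ n : ℕ, t ≠ Sum.inr (Sum.inr n)

def factNullFree (f : Fact) : Prop := ∀ t ∈ f.2, ∀ n : ℕ, t ≠ Sum.inr n

/-- A database is a finite fact set without nulls. -/
def IsDatabase (D : Database) : Prop := ∀ f ∈ D, factNullFree f

/-- Well-formed rule: non-empty head, no nulls. -/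
def IsRule (r : Rule) : Prop := r.2 ≠ [] ∧ ∀ a ∈ r.1 ++ r.2, atomNullFree a

def IsRuleSet (S : RuleSet) : Prop := ∀ r ∈ S, IsRule r

def IsKB (kb : KB) : Prop := IsRuleSet kb.1 ∧ IsDatabase kb.2

/-- `v` occurs in the body of `r` (i.e. is universally quantified). -/
def bodyVar (r : Rule) (v : ℕ) : Prop := ∃ a ∈ r.1, atomHasVar a v

/-- `v` is an existential variable of `r`. -/
def existVar (r : Rule) (v : ℕ) : Prop := (∃ a ∈ r.2, atomHasVar a v) ∧ ¬ bodyVar r v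

def applyT (σ : ℕ → GroundTerm) : RTerm → GroundTerm
  | Sum.inl v => σ v
  | Sum.inr g => g

def applyA (σ : ℕ → GroundTerm) (a : Atom) : Fact := (a.1, a.2.map (applyT σ))

/-- A trigger: a rule together with a substitution for its (universal) variables. -/
abbrev Trigger : Type := Rule × (ℕ → GroundTerm)

/-- The support of a trigger: the instantiated body. -/
def support (t : Trigger) : Set Fact := {f | ∃ a ∈ t.1.1, f = applyA t.2 a}

/-- A trigger is loaded for `F` if `F` includes its support. -/
def loaded (t : Trigger) (F : Set Fact) : Prop := ∀ a ∈ t.1.1, applyA t.2 a ∈ F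

/-- `σ'` agrees with the substitution of `t` on all universally quantified (body) variables. -/
def agreesOnBody (t : Trigger) (σ' : ℕ → GroundTerm) : Prop :=
  ∀ v, bodyVar t.1 v → σ' v = t.2 v

/-- A trigger is obsolete for `F` if some extension of its substitution to the existential
variables sends the head into `F`. -/
def obsolete (t : Trigger) (F : Set Fact) : Prop :=
  ∃ σ' : ℕ → GroundTerm, agreesOnBody t σ' ∧ ∀ a ∈ t.1.2, applyA σ' a ∈ F

/-- The (ground) terms occurring in a fact set. -/
def termsOf (F : Set Fact) : Set GroundTerm := {g | ∃ f ∈ F, g ∈ f.2}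

/-- `σ'` is a proper output extension of the trigger `t` w.r.t. `F`: it agrees with the trigger
substitution on body variables and maps existential variables to pairwise distinct fresh nulls. -/
def properExt (t : Trigger) (F : Set Fact) (σ' : ℕ → GroundTerm) : Prop :=
  agreesOnBody t σ' ∧
  (∀ v, existVar t.1 v → ∃ n : ℕ, σ' v = Sum.inr n ∧ (Sum.inr n : GroundTerm) ∉ termsOf F) ∧
  (∀ v w, existVar t.1 v → existVar t.1 w → σ' v = σ' w → v = w)

/-- The output of a trigger under an extended substitution. -/
def outputOf (t : Trigger) (σ' : ℕ → GroundTerm) : Set Fact := {f | ∃ a ∈ t.1.2, f = applyA σ' a}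

/-- An active trigger of `S` for `F`: loaded and not obsolete. -/
def Active (S : RuleSet) (F : Set Fact) (t : Trigger) : Prop :=
  t.1 ∈ S ∧ loaded t F ∧ ¬ obsolete t F

/-- One restricted chase step. -/
def ChaseStep (S : RuleSet) (F F' : Set Fact) : Prop :=
  ∃ t : Trigger, Active S F t ∧ ∃ σ', properExt t F σ' ∧ F' = F ∪ outputOf t σ'

def dbSet (D : Database) : Set Fact := {f | f ∈ D}

/-- A (possibly infinite) restricted chase derivation for `⟨S, D⟩`, of length `len ∈ ℕ∞`.
Beyond the length the fact sets stall, so that the result is always `⋃ i, fact i`. -/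
structure Chase (S : RuleSet) (D : Set Fact) where
  len : ℕ∞
  fact : ℕ → Set Fact
  trig : ℕ → Trigger
  ext : ℕ → ℕ → GroundTerm
  init : fact 0 = D
  activeAt : ∀ i : ℕ, (i : ℕ∞) < len → Active S (fact i) (trig i)
  extOk : ∀ i : ℕ, (i : ℕ∞) < len → properExt (trig i) (fact i) (ext i)
  succ : ∀ i : ℕ, (i : ℕ∞) < len → fact (i + 1) = fact i ∪ outputOf (trig i) (ext i)
  stall : ∀ i : ℕ, ¬ ((i : ℕ∞) < len) → fact (i + 1) = fact i

/-- Fairness: every trigger that becomes loaded is eventually obsolete.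
A fair chase derivation is a *restricted chase sequence*; note that for a finite derivation
fairness forces maximality (no active trigger remains at the end). -/
def Fair {S : RuleSet} {D : Set Fact} (c : Chase S D) : Prop :=
  ∀ t : Trigger, t.1 ∈ S → ∀ i : ℕ, loaded t (c.fact i) → ∃ j : ℕ, i ≤ j ∧ obsolete t (c.fact j)

/-- The result of a chase derivation. -/
def chaseResult {S : RuleSet} {D : Set Fact} (c : Chase S D) : Set Fact := ⋃ i, c.fact i

/-- The derivation is infinite (non-terminating). -/
def IsInfinite {S : RuleSet} {D : Set Fact} (c : Chase S D) : Prop := c.len = ⊤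

/-- `TKR∀`: knowledge bases all of whose restricted chase sequences are finite. -/
def TKRall (kb : KB) : Prop :=
  IsKB kb ∧ ¬ ∃ c : Chase kb.1 (dbSet kb.2), IsInfinite c ∧ Fair c

/-- `TRR∀`: rule sets universally terminating for the restricted chase on every database. -/
def TRRall (S : RuleSet) : Prop :=
  IsRuleSet S ∧ ∀ D : Database, IsDatabase D → ¬ ∃ c : Chase S (dbSet D), IsInfinite c ∧ Fair c

/-! ### Breadth-first chase -/

/-- The instance of a trigger: its rule together with its instantiated body (this determines the
substitution on all body variables). -/
def instOf (t : Trigger) : Rule × List Fact := (t.1, t.1.1.map (applyA t.2))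

/-- The set of instances of active triggers (this is what "the number of triggers that are loaded
and not obsolete" counts). -/
def activeInsts (S : RuleSet) (F : Set Fact) : Set (Rule × List Fact) :=
  {p | ∃ t : Trigger, Active S F t ∧ p = instOf t}

/-- The breadth-first condition (†): a trigger loaded at step `i` becomes obsolete within the
next `n` steps, where `n` is the number of active triggers at step `i`. -/
def BreadthFirst {S : RuleSet} {D : Set Fact} (c : Chase S D) : Prop :=
  ∀ i : ℕ, ∀ t : Trigger, t.1 ∈ S → loaded t (c.fact i) →
    ∃ j : ℕ, i ≤ j ∧ j ≤ i + (activeInsts S (c.fact i)).ncard ∧ obsolete t (c.fact j)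

/-- `TKRBF∀`: knowledge bases all of whose breadth-first chase sequences are finite. -/
def TKRBFall (kb : KB) : Prop :=
  IsKB kb ∧ ¬ ∃ c : Chase kb.1 (dbSet kb.2), IsInfinite c ∧ BreadthFirst c

/-- `TRRBF∀`: rule sets whose breadth-first chase terminates on every database. -/
def TRRBFall (S : RuleSet) : Prop :=
  IsRuleSet S ∧ ∀ D : Database, IsDatabase D →
    ¬ ∃ c : Chase S (dbSet D), IsInfinite c ∧ BreadthFirst c

/-! ### Classes of the arithmetical and analytical hierarchies -/

/-- `Π⁰₂` predicates, via the Kleene normal form `∀ m ∃ k. R`. -/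
def Pi02 {α : Type} [Primcodable α] (p : α → Prop) : Prop :=
  ∃ R : α × ℕ → ℕ → Bool, Computable₂ R ∧ ∀ a, p a ↔ ∀ m : ℕ, ∃ k : ℕ, R (a, m) k = true

/-- `Π¹₁` predicates, via the Kleene normal form: `p a` iff for every function `f : ℕ → ℕ` some
finite initial segment of `f` witnesses a computable predicate. -/
def Pi11 {α : Type} [Primcodable α] (p : α → Prop) : Prop :=
  ∃ R : α → List ℕ → Bool, Computable₂ R ∧
    ∀ a, p a ↔ ∀ f : ℕ → ℕ, ∃ k : ℕ, R a ((List.range k).map f) = true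

/-- `Π¹₁`-hardness: every `Π¹₁` problem many-one reduces to `p`. -/
def Pi11Hard {α : Type} [Primcodable α] (p : α → Prop) : Prop :=
  ∀ q : ℕ → Prop, Pi11 q → q ≤₀ p

def Pi11Complete {α : Type} [Primcodable α] (p : α → Prop) : Prop := Pi11 p ∧ Pi11Hard p

/-! ### Non-deterministic Turing machines -/

/-- A non-deterministic Turing machine `(numStates, alphaSize, table)`.
States are `0, …, numStates - 1` with initial state `0`; tape symbols `0, …, alphaSize - 1`
form `Γ` (so `{0,1} ⊆ Γ` iff `2 ≤ alphaSize`), and the blank `B` is coded by `alphaSize`.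
An entry `((q, a), (q', b, d))` means `(q', b, d) ∈ δ(q, a)`, with `d = true` for a right move
and `d = false` for a left move. -/
abbrev NTM : Type := ℕ × ℕ × List ((ℕ × ℕ) × (ℕ × ℕ × Bool))

def NTM.numStates (M : NTM) : ℕ := M.1
def NTM.blank (M : NTM) : ℕ := M.2.1
def NTM.table (M : NTM) : List ((ℕ × ℕ) × (ℕ × ℕ × Bool)) := M.2.2

/-- Well-formedness: `Γ ⊇ {0,1}`, transitions use valid states and symbols, and the machine
never writes the blank. -/
def NTM.WF (M : NTM) : Prop :=
  1 ≤ NTM.numStates M ∧ 2 ≤ NTM.blank M ∧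
    ∀ e ∈ NTM.table M, e.1.1 < NTM.numStates M ∧ e.1.2 ≤ NTM.blank M ∧
      e.2.1 < NTM.numStates M ∧ e.2.2.1 < NTM.blank M

/-- A configuration `(tape, p, q)`: tape contents (a list of symbol codes whose last cell is
blank and in which no proper symbol occurs after a blank), 0-based head position `p`,
and current state `q`. -/
abbrev Config : Type := List ℕ × ℕ × ℕ

def WFConfig (M : NTM) (ρ : Config) : Prop :=
  ρ.2.1 < ρ.1.length ∧ ρ.1.getLast? = some (NTM.blank M) ∧
    (∀ i j : ℕ, i ≤ j → j < ρ.1.length → ρ.1.getD i 0 = NTM.blank M →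
      ρ.1.getD j 0 = NTM.blank M) ∧
    (∀ a ∈ ρ.1, a ≤ NTM.blank M) ∧ ρ.2.2 < NTM.numStates M

/-- The one-step relation `Next_M` between configurations; each step extends the represented
part of the tape by one blank cell. -/
def NTM.Next (M : NTM) (ρ ρ' : Config) : Prop :=
  ∃ q' b : ℕ, ∃ d : Bool,
    ((ρ.2.2, ρ.1.getD ρ.2.1 0), (q', b, d)) ∈ NTM.table M ∧
    (d = true ∨ 1 ≤ ρ.2.1) ∧
    ρ' = (ρ.1.set ρ.2.1 b ++ [NTM.blank M], if d then ρ.2.1 + 1 else ρ.2.1 - 1, q')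

/-- The starting configuration of `M` on a word. -/
def startConfig (M : NTM) (w : List ℕ) : Config := (w ++ [NTM.blank M], 0, 0)

/-- Words are over the input alphabet `{0, 1}`. -/
def IsWord (w : List ℕ) : Prop := ∀ a ∈ w, a < 2

/-- There is a run of `M` starting in `ρ` that visits the state `qr` infinitely often.
(Such a run is necessarily infinite, and every infinite sequence of `Next_M`-successive
configurations is a run; finite runs trivially feature `qr` only finitely many times.) -/
def RecurringFrom (M : NTM) (qr : ℕ) (ρ : Config) : Prop :=
  ∃ c : ℕ → Config, c 0 = ρ ∧ (∀ i, NTM.Next M (c i) (c (i + 1))) ∧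
    ∀ N : ℕ, ∃ i : ℕ, N ≤ i ∧ (c i).2.2 = qr

/-- `M` is non-recurring through `qr` on the configuration `ρ`: every run of `M` on `ρ`
features `qr` only finitely many times. -/
def NonRecurringFrom (M : NTM) (qr : ℕ) (ρ : Config) : Prop := ¬ RecurringFrom M qr ρ

end ChaseTermination
namespace ChaseTermination

/-! ### The rule set `Σ_M` of Section 4 and the databases `D_ρ` -/

/-- Predicate codes. `pF`, `pR` are the ternary time/tape successor predicates. -/
def pF : ℕ := 0
def pR : ℕ := 1
def pCL : ℕ := 2
def pCR : ℕ := 3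
def pReal : ℕ := 4
def pBrake : ℕ := 5
def pNextBr : ℕ := 6
def pEnd : ℕ := 7
/-- The binary letter predicate for the tape symbol `a`. -/
def pLetter (a : ℕ) : ℕ := 8 + 2 * a
/-- The binary state predicate for the state `q`. -/
def pState (q : ℕ) : ℕ := 9 + 2 * q

/-- Variable codes used in the rules: `x, y, x', y', w, w'` are `0, …, 5`. -/
def tv (v : ℕ) : RTerm := Sum.inl v

def A1 (p : ℕ) (s : RTerm) : Atom := (p, [s])
def A2 (p : ℕ) (s t : RTerm) : Atom := (p, [s, t])
def A3 (p : ℕ) (s t u : RTerm) : Atom := (p, [s, t, u])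

/-- `brSet(x, w)` as atoms: `{F(x,w,w), R(x,w,w), Real(x), Brake(w)}`. -/
def brSetA (x w : RTerm) : List Atom := [A3 pF x w w, A3 pR x w w, A1 pReal x, A1 pBrake w]

/-- Tape alphabet including the blank: `Γ ∪ {B}`. -/
def letters (M : NTM) : List ℕ := List.range (NTM.blank M + 1)
def states (M : NTM) : List ℕ := List.range (NTM.numStates M)

/-- The rule `R_Brake`. -/
def ruleBrake (M : NTM) : Rule :=
  ([A1 pBrake (tv 4)],
    ((letters M).map fun a => A2 (pLetter a) (tv 4) (tv 4)) ++
    ((states M).map fun q => A2 (pState q) (tv 4) (tv 4)) ++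
    [A3 pF (tv 4) (tv 4) (tv 4), A3 pR (tv 4) (tv 4) (tv 4),
     A2 pCL (tv 4) (tv 4), A2 pCR (tv 4) (tv 4), A1 pReal (tv 4), A2 pNextBr (tv 4) (tv 4)])

/-- The rule `R_nextBr`. -/
def ruleNextBr : Rule :=
  (brSetA (tv 0) (tv 4) ++ [A2 pNextBr (tv 4) (tv 5)], brSetA (tv 0) (tv 5))

/-- Transition rule for `(q', b, →) ∈ δ(q, a)` and the letter `c`; if `q = qr` a fresh
brake `w'` is created together with a `nextBr`-atom, otherwise the brake `w` is reused. -/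
def mkTransRight (qr q a q' b c : ℕ) : Rule :=
  ([A2 (pState q) (tv 0) (tv 4), A2 (pLetter a) (tv 0) (tv 4), A3 pR (tv 0) (tv 1) (tv 4),
    A2 (pLetter c) (tv 1) (tv 4)] ++ brSetA (tv 0) (tv 4) ++ brSetA (tv 1) (tv 4),
   if q = qr then
     [A2 (pState q') (tv 3) (tv 5), A2 (pLetter c) (tv 3) (tv 5), A2 (pLetter b) (tv 2) (tv 5),
      A3 pR (tv 2) (tv 3) (tv 5), A3 pF (tv 0) (tv 2) (tv 5), A3 pF (tv 1) (tv 3) (tv 5),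
      A2 pCL (tv 2) (tv 5), A2 pCR (tv 3) (tv 5)] ++
      brSetA (tv 2) (tv 5) ++ brSetA (tv 3) (tv 5) ++ [A2 pNextBr (tv 4) (tv 5)]
   else
     [A2 (pState q') (tv 3) (tv 4), A2 (pLetter c) (tv 3) (tv 4), A2 (pLetter b) (tv 2) (tv 4),
      A3 pR (tv 2) (tv 3) (tv 4), A3 pF (tv 0) (tv 2) (tv 4), A3 pF (tv 1) (tv 3) (tv 4),
      A2 pCL (tv 2) (tv 4), A2 pCR (tv 3) (tv 4)] ++ brSetA (tv 2) (tv 4) ++ brSetA (tv 3) (tv 4))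

/-- Transition rule for `(q', b, ←) ∈ δ(q, a)` and the letter `c`. -/
def mkTransLeft (qr q a q' b c : ℕ) : Rule :=
  ([A2 (pState q) (tv 0) (tv 4), A2 (pLetter a) (tv 0) (tv 4), A3 pR (tv 1) (tv 0) (tv 4),
    A2 (pLetter c) (tv 1) (tv 4)] ++ brSetA (tv 0) (tv 4) ++ brSetA (tv 1) (tv 4),
   if q = qr then
     [A2 (pState q') (tv 3) (tv 5), A2 (pLetter c) (tv 3) (tv 5), A2 (pLetter b) (tv 2) (tv 5),
      A3 pR (tv 3) (tv 2) (tv 5), A3 pF (tv 0) (tv 2) (tv 5), A3 pF (tv 1) (tv 3) (tv 5),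
      A2 pCL (tv 3) (tv 5), A2 pCR (tv 2) (tv 5)] ++
      brSetA (tv 2) (tv 5) ++ brSetA (tv 3) (tv 5) ++ [A2 pNextBr (tv 4) (tv 5)]
   else
     [A2 (pState q') (tv 3) (tv 4), A2 (pLetter c) (tv 3) (tv 4), A2 (pLetter b) (tv 2) (tv 4),
      A3 pR (tv 3) (tv 2) (tv 4), A3 pF (tv 0) (tv 2) (tv 4), A3 pF (tv 1) (tv 3) (tv 4),
      A2 pCL (tv 3) (tv 4), A2 pCR (tv 2) (tv 4)] ++ brSetA (tv 2) (tv 4) ++ brSetA (tv 3) (tv 4))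

/-- All transition rules of `Σ_M` (one per table entry and letter `c`). -/
def transRules (M : NTM) (qr : ℕ) : List Rule :=
  (NTM.table M).foldr (fun e acc =>
    ((letters M).map fun cc =>
      if e.2.2.2 = true then mkTransRight qr e.1.1 e.1.2 e.2.1 e.2.2.1 cc
      else mkTransLeft qr e.1.1 e.1.2 e.2.1 e.2.2.1 cc) ++ acc) []

/-- The rule `R_{C_R}` for the letter `a`. -/
def mkCopyRight (a : ℕ) : Rule :=
  ([A2 pCR (tv 2) (tv 5), A3 pF (tv 0) (tv 2) (tv 5), A3 pR (tv 0) (tv 1) (tv 4),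
    A2 (pLetter a) (tv 1) (tv 4)] ++
    brSetA (tv 0) (tv 4) ++ brSetA (tv 2) (tv 5) ++ brSetA (tv 1) (tv 4),
   [A3 pF (tv 1) (tv 3) (tv 5), A3 pR (tv 2) (tv 3) (tv 5), A2 (pLetter a) (tv 3) (tv 5),
    A2 pCR (tv 3) (tv 5)] ++ brSetA (tv 3) (tv 5))

/-- The rule `R_{C_L}` for the letter `a`. -/
def mkCopyLeft (a : ℕ) : Rule :=
  ([A2 pCL (tv 2) (tv 5), A3 pF (tv 0) (tv 2) (tv 5), A3 pR (tv 1) (tv 0) (tv 4),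
    A2 (pLetter a) (tv 1) (tv 4)] ++
    brSetA (tv 0) (tv 4) ++ brSetA (tv 2) (tv 5) ++ brSetA (tv 1) (tv 4),
   [A3 pF (tv 1) (tv 3) (tv 5), A3 pR (tv 3) (tv 2) (tv 5), A2 (pLetter a) (tv 3) (tv 5),
    A2 pCL (tv 3) (tv 5)] ++ brSetA (tv 3) (tv 5))

def copyRightRules (M : NTM) : List Rule := (letters M).map mkCopyRight
def copyLeftRules (M : NTM) : List Rule := (letters M).map mkCopyLeft

/-- The tape-extension rule `R_End`. -/
def ruleEnd (M : NTM) : Rule :=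
  ([A2 pCR (tv 2) (tv 5), A3 pF (tv 0) (tv 2) (tv 5), A2 pEnd (tv 0) (tv 4)] ++
    brSetA (tv 0) (tv 4) ++ brSetA (tv 2) (tv 5),
   [A3 pR (tv 2) (tv 3) (tv 5), A2 (pLetter (NTM.blank M)) (tv 3) (tv 5),
    A2 pEnd (tv 3) (tv 5)] ++ brSetA (tv 3) (tv 5))

/-- The rule set `Σ_M` of Section 4 (simulating `M`, with the designated state `qr`). -/
def SigmaM (M : NTM) (qr : ℕ) : RuleSet :=
  [ruleBrake M, ruleNextBr] ++ transRules M qr ++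
    copyLeftRules M ++ copyRightRules M ++ [ruleEnd M]

/-- The constant `c_i` (0-based). -/
def cst (i : ℕ) : GroundTerm := Sum.inl (i + 1)
/-- The brake constant `w₁` of the database. -/
def w1 : GroundTerm := Sum.inl 0

/-- `brSet(x, w)` as facts. -/
def brSetF (x w : GroundTerm) : List Fact :=
  [(pF, [x, w, w]), (pR, [x, w, w]), (pReal, [x]), (pBrake, [w])]

/-- The database `D_ρ` encoding a configuration `ρ`. -/
def Drho (M : NTM) (ρ : Config) : Database :=
  ((List.range ρ.1.length).map fun i => ((pR, [cst i, cst (i + 1), w1]) : Fact)) ++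
  ((List.range ρ.1.length).map fun i => ((pLetter (ρ.1.getD i 0), [cst i, w1]) : Fact)) ++
  [((pState ρ.2.2, [cst ρ.2.1, w1]) : Fact),
   ((pLetter (NTM.blank M), [cst ρ.1.length, w1]) : Fact),
   ((pEnd, [cst ρ.1.length, w1]) : Fact)] ++
  (List.range (ρ.1.length + 1)).foldr (fun i acc => brSetF (cst i) w1 ++ acc) []

/-! ### Wild frontiers -/

/-- The atoms explicitly required by the wild-frontier condition ("other" atoms are those
not in this set). -/
def wfListed (M : NTM) (ρ : Config) (w : GroundTerm) (x : ℕ → GroundTerm) : Set Fact :=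
  {f | (∃ i < ρ.1.length,
          f = ((pR, [x i, x (i + 1), w]) : Fact) ∨
          f = ((pLetter (ρ.1.getD i 0), [x i, w]) : Fact)) ∨
    f = ((pState ρ.2.2, [x ρ.2.1, w]) : Fact) ∨
    f = ((pEnd, [x ρ.1.length, w]) : Fact) ∨
    f = ((pLetter (NTM.blank M), [x ρ.1.length, w]) : Fact) ∨
    (∃ i ≤ ρ.1.length, f ∈ brSetF (x i) w)}

/-- `F` has a wild frontier of the configuration `ρ` overseen by `w` (Definition 4.4). -/
def WildFrontier (M : NTM) (F : Set Fact) (ρ : Config) (w : GroundTerm) : Prop :=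
  ∃ x : ℕ → GroundTerm,
    ((pReal, [w]) : Fact) ∉ F ∧
    (∀ i < ρ.1.length, ((pR, [x i, x (i + 1), w]) : Fact) ∈ F ∧
      ((pLetter (ρ.1.getD i 0), [x i, w]) : Fact) ∈ F) ∧
    ((pState ρ.2.2, [x ρ.2.1, w]) : Fact) ∈ F ∧
    ((pEnd, [x ρ.1.length, w]) : Fact) ∈ F ∧
    ((pLetter (NTM.blank M), [x ρ.1.length, w]) : Fact) ∈ F ∧
    (∀ i ≤ ρ.1.length, ∀ f ∈ brSetF (x i) w, f ∈ F) ∧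
    (∀ f ∈ F, f ∉ wfListed M ρ w x →
      ∀ i ≤ ρ.1.length, f.2.head? = some (x i) → f.2[1]? = some w)

/-! ### State atoms, generation, bow ties -/

/-- `g` is a brake of `F`. -/
def isBrake (F : Set Fact) (g : GroundTerm) : Prop := ((pBrake, [g]) : Fact) ∈ F

/-- A state atom of `F`: an atom `q(x, w)` with `q` a state of `M` and `x` not a brake. -/
def StateAtom (M : NTM) (F : Set Fact) (f : Fact) : Prop :=
  ∃ q : ℕ, q < NTM.numStates M ∧ ∃ x wb : GroundTerm,
    f = ((pState q, [x, wb]) : Fact) ∧ f ∈ F ∧ ¬ isBrake F x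

/-- `A` precedes `A'` in the derivation `c`: some applied trigger has `A` in its support
and `A'` in its output. -/
def precedes {S : RuleSet} {D : Set Fact} (c : Chase S D) (A A' : Fact) : Prop :=
  ∃ i : ℕ, (i : ℕ∞) < c.len ∧ A ∈ support (c.trig i) ∧ A' ∈ outputOf (c.trig i) (c.ext i)

/-- The fact `f` is generated (newly produced) at step `i` of the derivation `c`. -/
def generatedAt {S : RuleSet} {D : Set Fact} (c : Chase S D) (i : ℕ) (f : Fact) : Prop :=
  (i : ℕ∞) < c.len ∧ f ∈ outputOf (c.trig i) (c.ext i) ∧ f ∉ c.fact i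

/-- The fact `f` is generated by (an application of) one of the rules in `Rs`. -/
def generatedBy {S : RuleSet} {D : Set Fact} (c : Chase S D) (Rs : List Rule) (f : Fact) : Prop :=
  ∃ i : ℕ, generatedAt c i f ∧ (c.trig i).1 ∈ Rs

/-- Semantically meaningful terms: all terms of `F` except the brakes. -/
def semterms (F : Set Fact) : Set GroundTerm := {g | g ∈ termsOf F ∧ ¬ isBrake F g}

/-- The edge relation `E_R`: `(x, y) ∈ E_R` iff `R(x, y, w) ∈ F` for some `w`. -/
def ER (F : Set Fact) (u v : GroundTerm) : Prop := ∃ w, ((pR, [u, v, w]) : Fact) ∈ F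

/-- The weakly connected component of `x` in the graph induced by `E` on the vertex set `V`. -/
def wcc {α : Type} (V : Set α) (E : α → α → Prop) (x : α) : Set α :=
  {z | z ∈ V ∧ Relation.ReflTransGen (fun u v => u ∈ V ∧ v ∈ V ∧ (E u v ∨ E v u)) x z}

/-- Directed tree rooted in `r` on the vertex set `V` with edge relation `E`. -/
def IsDirTree {α : Type} (V : Set α) (E : α → α → Prop) (r : α) : Prop :=
  r ∈ V ∧
  (∀ v ∈ V, Relation.ReflTransGen (fun u v' => u ∈ V ∧ v' ∈ V ∧ E u v') r v) ∧
  (∀ v ∈ V, v ≠ r → ∃! u, u ∈ V ∧ E u v) ∧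
  (∀ u ∈ V, ¬ E u r)

/-- A bow tie with center `(x, y)` (Definition 6.2): `V_x^{-y}` induces a directed tree on the
inverse edges rooted in `x`, `V_y^{-x}` induces a directed tree rooted in `y`, and the two
components partition `V`. -/
def IsBowTie {α : Type} (V : Set α) (E : α → α → Prop) (x y : α) : Prop :=
  x ∈ V ∧ y ∈ V ∧ E x y ∧
  IsDirTree (wcc (V \ {y}) E x) (fun u v => E v u) x ∧
  IsDirTree (wcc (V \ {x}) E y) E y ∧
  wcc (V \ {y}) E x ∩ wcc (V \ {x}) E y = ∅ ∧
  wcc (V \ {y}) E x ∪ wcc (V \ {x}) E y = V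

/-- `bowtie(A)` for a state atom `q(x, w)`: the weakly connected component of `x` in
`(semterms F, E_R)`. -/
def bowtieOf (F : Set Fact) (x : GroundTerm) : Set GroundTerm := wcc (semterms F) (ER F) x

/-- A maximal `E`-path in the vertex set `V`. -/
def IsMaxPath {α : Type} (V : Set α) (E : α → α → Prop) (l : List α) : Prop :=
  l ≠ [] ∧ (∀ z ∈ l, z ∈ V) ∧ List.Chain' E l ∧
  (∀ z ∈ V, ∀ a, l.head? = some a → ¬ E z a) ∧
  (∀ z ∈ V, ∀ a, l.getLast? = some a → ¬ E a z)

/-- `configs(A)` (Definition 6.4): one candidate configuration per maximal path of `bowtie(A)`. -/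
def configsOf (M : NTM) (F : Set Fact) (A : Fact) : Set (Set Fact) :=
  {S | ∃ q : ℕ, ∃ x w : GroundTerm, A = ((pState q, [x, w]) : Fact) ∧
    ∃ l : List GroundTerm, IsMaxPath (bowtieOf F x) (ER F) l ∧
      S = insert A
        ({f | ∃ z ∈ l, f ∈ brSetF z w} ∪
         {f | f ∈ F ∧ (f.1 = pR ∨ f.1 = pEnd ∨ ∃ a ∈ letters M, f.1 = pLetter a) ∧
           f.2 ≠ [] ∧ f.2.getLast? = some w ∧ ∀ z ∈ f.2.dropLast, z ∈ l})}

/-- Homomorphic embedding of fact sets: a map on nulls (fixing all constants) sending `S`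
into `T`. -/
def mapG (h : ℕ → GroundTerm) : GroundTerm → GroundTerm
  | Sum.inl cc => Sum.inl cc
  | Sum.inr n => h n

def mapFact (h : ℕ → GroundTerm) (f : Fact) : Fact := (f.1, f.2.map (mapG h))

def HomEmbeds (S T : Set Fact) : Prop := ∃ h : ℕ → GroundTerm, ∀ f ∈ S, mapFact h f ∈ T

end ChaseTermination
namespace ChaseTermination

/-! ### The machine `M_Σ` (Definition 4.1), modelled by its canonical runs

A run of `M_Σ` on the encoding of a database corresponds exactly to a restricted chase
derivation of `⟨Σ, D⟩` (step 4 of the procedure) together with the counter `j`; the machine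
visits its designated state `q_r` once each time `j` is incremented (step 5), so a run visits
`q_r` infinitely often iff the derivation is infinite and `jseq` is unbounded. -/

open scoped Classical in
/-- The value of the counter `j` of `M_Σ` after `i` iterations of its main loop, when its
non-deterministic choices build the chase derivation `c`. -/
noncomputable def jseq {S : RuleSet} {D : Set Fact} (c : Chase S D) : ℕ → ℕ
  | 0 => 0
  | i + 1 =>
      if ∀ t : Trigger, Active S (c.fact (jseq c i)) t → obsolete t (c.fact i) then
        jseq c i + 1
      else jseq c i

/-! ### Oblivious and core chase variants -/

/-- A (possibly infinite) oblivious chase derivation: triggers need only be loaded, but no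
trigger (instance) is ever applied twice. -/
structure OblChase (S : RuleSet) (D : Set Fact) where
  len : ℕ∞
  fact : ℕ → Set Fact
  trig : ℕ → Trigger
  ext : ℕ → ℕ → GroundTerm
  init : fact 0 = D
  memAt : ∀ i : ℕ, (i : ℕ∞) < len → (trig i).1 ∈ S
  loadAt : ∀ i : ℕ, (i : ℕ∞) < len → loaded (trig i) (fact i)
  noRepeat : ∀ i j : ℕ, (i : ℕ∞) < len → (j : ℕ∞) < len →
    instOf (trig i) = instOf (trig j) → i = j
  extOk : ∀ i : ℕ, (i : ℕ∞) < len → properExt (trig i) (fact i) (ext i)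
  succ : ∀ i : ℕ, (i : ℕ∞) < len → fact (i + 1) = fact i ∪ outputOf (trig i) (ext i)
  stall : ∀ i : ℕ, ¬ ((i : ℕ∞) < len) → fact (i + 1) = fact i

/-- Fairness for the oblivious chase: every trigger that becomes loaded is eventually applied. -/
def OblFair {S : RuleSet} {D : Set Fact} (c : OblChase S D) : Prop :=
  ∀ t : Trigger, t.1 ∈ S → ∀ i : ℕ, loaded t (c.fact i) →
    ∃ j : ℕ, (j : ℕ∞) < c.len ∧ instOf (c.trig j) = instOf t

/-- `H` is a retract of `G`: `H ⊆ G` and some homomorphism (fixing constants) maps `G` into `H`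
leaving `H` pointwise fixed. -/
def RetractOf (G H : Set Fact) : Prop :=
  H ⊆ G ∧ ∃ h : ℕ → GroundTerm, (∀ f ∈ G, mapFact h f ∈ H) ∧ ∀ f ∈ H, mapFact h f = f

/-- `H` is a core of `G`: a retract of `G` without proper retracts. -/
def IsCoreOf (H G : Set Fact) : Prop := RetractOf G H ∧ ∀ H', RetractOf H H' → H' = H

/-- `G` is obtained from `F` by applying all active triggers in parallel, each with fresh
pairwise distinct nulls (distinct trigger instances use disjoint fresh nulls). -/
def IsParallelStep (S : RuleSet) (F G : Set Fact) : Prop :=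
  ∃ pe : Trigger → (ℕ → GroundTerm),
    (∀ t : Trigger, Active S F t → properExt t F (pe t)) ∧
    (∀ t t' : Trigger, Active S F t → Active S F t' → instOf t = instOf t' →
      outputOf t (pe t) = outputOf t' (pe t')) ∧
    (∀ t t' : Trigger, Active S F t → Active S F t' → instOf t ≠ instOf t' →
      ∀ n : ℕ, (Sum.inr n : GroundTerm) ∉ termsOf F →
        (Sum.inr n : GroundTerm) ∈ termsOf (outputOf t (pe t)) →
        (Sum.inr n : GroundTerm) ∉ termsOf (outputOf t' (pe t'))) ∧
    G = F ∪ ⋃ t ∈ {t : Trigger | Active S F t}, outputOf t (pe t)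

/-- A (possibly infinite) core chase sequence: `F_{i+1}` is a core of the parallel application
of all active triggers to `F_i`, and the sequence stops exactly when this is a fixpoint. -/
structure CoreChase (S : RuleSet) (D : Set Fact) where
  len : ℕ∞
  fact : ℕ → Set Fact
  init : fact 0 = D
  step : ∀ i : ℕ, (i : ℕ∞) < len →
    ∃ G, IsParallelStep S (fact i) G ∧ IsCoreOf (fact (i + 1)) G ∧ fact (i + 1) ≠ fact i
  halt : ∀ i : ℕ, ¬ ((i : ℕ∞) < len) → ∃ G, IsParallelStep S (fact i) G ∧ IsCoreOf (fact i) G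
  stall : ∀ i : ℕ, ¬ ((i : ℕ∞) < len) → fact (i + 1) = fact i

/-- The three chase variants. -/
inductive Variant : Type | obl | rest | core

/-- `qExists` ("sometimes") and `qForall` ("always") termination. -/
inductive Quant : Type | qExists | qForall

/-- `Terminates v q S D`: the knowledge base `⟨S, D⟩` `q`-terminates for the chase variant `v`
(`qExists`: some chase sequence is finite; `qForall`: all chase sequences are finite). -/
def Terminates (v : Variant) (q : Quant) (S : RuleSet) (D : Set Fact) : Prop :=
  match v, q with
  | .rest, .qExists => ∃ c : Chase S D, Fair c ∧ c.len ≠ ⊤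
  | .rest, .qForall => ∀ c : Chase S D, Fair c → c.len ≠ ⊤
  | .obl, .qExists => ∃ c : OblChase S D, OblFair c ∧ c.len ≠ ⊤
  | .obl, .qForall => ∀ c : OblChase S D, OblFair c → c.len ≠ ⊤
  | .core, .qExists => ∃ c : CoreChase S D, c.len ≠ ⊤
  | .core, .qForall => ∀ c : CoreChase S D, c.len ≠ ⊤

end ChaseTermination

namespace ChaseTermination

open Nat.Partrec (Code)
open Nat.Partrec.Code

/-! ### Generalities on restricted chase steps -/

/-- The atom with predicate `p` applied to the variables `vs`. -/
def varAtom (q : ℕ × List ℕ) : Atom := (q.1, q.2.map Sum.inl)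

/-- The constant-free rule with the given body and head. -/
def mkRule (b h : List (ℕ × List ℕ)) : Rule := (b.map varAtom, h.map varAtom)

theorem applyA_varAtom (σ : ℕ → GroundTerm) (q : ℕ × List ℕ) :
    applyA σ (varAtom q) = (q.1, q.2.map σ) := by
  simp [applyA, varAtom, Function.comp_def, applyT]

theorem loaded_mkRule {b h : List (ℕ × List ℕ)} {σ : ℕ → GroundTerm} {F : Set Fact} :
    loaded (mkRule b h, σ) F ↔ ∀ q ∈ b, ((q.1, q.2.map σ) : Fact) ∈ F := by
  simp only [loaded, mkRule, List.mem_map, forall_exists_index, and_imp,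
    forall_apply_eq_imp_iff₂, applyA_varAtom]

theorem mem_outputOf_mkRule {b h : List (ℕ × List ℕ)} {σ σ' : ℕ → GroundTerm} {f : Fact} :
    f ∈ outputOf (mkRule b h, σ) σ' ↔ ∃ q ∈ h, f = (q.1, q.2.map σ') := by
  simp only [outputOf, mkRule, List.mem_map, Set.mem_ofPred_eq]
  constructor
  · rintro ⟨_, ⟨q, hq, rfl⟩, rfl⟩
    exact ⟨q, hq, applyA_varAtom _ _⟩
  · rintro ⟨q, hq, rfl⟩
    exact ⟨_, ⟨q, hq, rfl⟩, (applyA_varAtom _ _).symm⟩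

theorem bodyVar_mkRule {b h : List (ℕ × List ℕ)} {v : ℕ} :
    bodyVar (mkRule b h) v ↔ ∃ q ∈ b, v ∈ q.2 := by
  simp [bodyVar, mkRule, atomHasVar, varAtom]

theorem existVar_mkRule {b h : List (ℕ × List ℕ)} {v : ℕ} :
    existVar (mkRule b h) v ↔ (∃ q ∈ h, v ∈ q.2) ∧ ¬ ∃ q ∈ b, v ∈ q.2 := by
  rw [existVar, bodyVar_mkRule]
  simp [mkRule, atomHasVar, varAtom]

theorem obsolete_mkRule {b h : List (ℕ × List ℕ)} {σ : ℕ → GroundTerm} {F : Set Fact} :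
    obsolete (mkRule b h, σ) F ↔ ∃ σ' : ℕ → GroundTerm, (∀ q ∈ b, ∀ v ∈ q.2, σ' v = σ v) ∧
      ∀ q ∈ h, ((q.1, q.2.map σ') : Fact) ∈ F := by
  simp only [obsolete, agreesOnBody, bodyVar_mkRule]
  simp only [mkRule, List.mem_map, forall_exists_index, and_imp, forall_apply_eq_imp_iff₂,
    applyA_varAtom]
  refine exists_congr fun σ' => and_congr ⟨?_, ?_⟩ Iff.rfl
  · exact fun H q hq v hv => H v q hq hv
  · rintro H v q hq hv
    exact H q hq v hv

theorem isRule_mkRule {b h : List (ℕ × List ℕ)} (hh : h ≠ []) : IsRule (mkRule b h) := by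
  refine ⟨by simpa [mkRule] using hh, ?_⟩
  intro a ha t ht n
  have : ∃ q, a = varAtom q := by
    simp only [mkRule, List.mem_append, List.mem_map] at ha
    grind
  obtain ⟨q, rfl⟩ := this
  simp only [varAtom, List.mem_map] at ht
  grind

/-- A rule without existential variables and without ground terms in its head. -/
def IsDatalog (r : Rule) : Prop := ∀ a ∈ r.2, ∀ t ∈ a.2, ∃ v, t = Sum.inl v ∧ bodyVar r v

theorem isDatalog_mkRule {b h : List (ℕ × List ℕ)}
    (H : ∀ q ∈ h, ∀ v ∈ q.2, ∃ q' ∈ b, v ∈ q'.2) : IsDatalog (mkRule b h) := by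
  intro a ha t ht
  simp only [mkRule, List.mem_map] at ha
  obtain ⟨q, hq, rfl⟩ := ha
  simp only [varAtom, List.mem_map] at ht
  obtain ⟨v, hv, rfl⟩ := ht
  exact ⟨v, rfl, bodyVar_mkRule.2 (H q hq v hv)⟩

theorem IsDatalog.applyA_eq {r : Rule} (hr : IsDatalog r) {σ σ' : ℕ → GroundTerm}
    (h : agreesOnBody (r, σ) σ') {a : Atom} (ha : a ∈ r.2) : applyA σ' a = applyA σ a := by
  simp only [applyA, Prod.mk.injEq, true_and]
  refine List.map_congr_left fun t ht => ?_
  obtain ⟨v, rfl, hv⟩ := hr a ha t ht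
  exact h v hv

theorem loaded.mono {t : Trigger} {F G : Set Fact} (h : loaded t F) (hFG : F ⊆ G) : loaded t G :=
  fun a ha => hFG (h a ha)

theorem ChaseStep.mono {S S' : RuleSet} (h : S ⊆ S') {F F' : Set Fact} (hs : ChaseStep S F F') :
    ChaseStep S' F F' := by
  obtain ⟨t, ⟨h1, h2⟩, h3⟩ := hs
  exact ⟨t, ⟨h h1, h2⟩, h3⟩

theorem ChaseStep.subset {S : RuleSet} {F F' : Set Fact} (hs : ChaseStep S F F') : F ⊆ F' := by
  obtain ⟨t, -, σ', -, rfl⟩ := hs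
  exact Set.subset_union_left

theorem subset_of_reflTransGen {S : RuleSet} {F F' : Set Fact}
    (h : Relation.ReflTransGen (ChaseStep S) F F') : F ⊆ F' := by
  induction h with
  | refl => exact subset_rfl
  | tail _ h ih => exact ih.trans h.subset

theorem finite_outputOf (t : Trigger) (σ : ℕ → GroundTerm) : (outputOf t σ).Finite := by
  refine (List.finite_toSet (t.1.2.map (applyA σ))).subset ?_
  rintro f ⟨a, ha, rfl⟩
  exact List.mem_map.2 ⟨a, ha, rfl⟩

theorem ChaseStep.finite {S : RuleSet} {F F' : Set Fact} (hs : ChaseStep S F F')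
    (hF : F.Finite) : F'.Finite := by
  obtain ⟨t, -, σ', -, rfl⟩ := hs
  exact hF.union (finite_outputOf _ _)

theorem finite_termsOf {F : Set Fact} (hF : F.Finite) : (termsOf F).Finite := by
  have : termsOf F = ⋃ f ∈ F, {g | g ∈ f.2} := by ext; simp [termsOf]
  rw [this]
  exact hF.biUnion fun f _ => List.finite_toSet _

theorem exists_properExt {F : Set Fact} (hF : F.Finite) (t : Trigger) : ∃ σ', properExt t F σ' := by
  classical
  have hfin : {n : ℕ | (Sum.inr n : GroundTerm) ∈ termsOf F}.Finite :=
    (finite_termsOf hF).preimage Sum.inr_injective.injOn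
  obtain ⟨M, hM⟩ := hfin.bddAbove
  refine ⟨fun v => if bodyVar t.1 v then t.2 v else Sum.inr (M + 1 + v), ?_, ?_, ?_⟩
  · intro v hv
    simp [hv]
  · intro v hv
    refine ⟨M + 1 + v, by simp [hv.2], fun h => ?_⟩
    have := hM h
    omega
  · intro v w hv hw h
    simpa [hv.2, hw.2] using h

theorem obsolete_of_properExt {t : Trigger} {F : Set Fact} {σ' : ℕ → GroundTerm}
    (h : properExt t F σ') : obsolete t (F ∪ outputOf t σ') :=
  ⟨σ', h.1, fun a ha => Or.inr ⟨a, ha, rfl⟩⟩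

/-- Every loaded trigger can be made obsolete by at most one chase step. -/
theorem exists_reflTransGen_obsolete {S : RuleSet} {F : Set Fact} (hF : F.Finite) {t : Trigger}
    (hS : t.1 ∈ S) (hl : loaded t F) :
    ∃ F', Relation.ReflTransGen (ChaseStep S) F F' ∧ obsolete t F' := by
  by_cases ho : obsolete t F
  · exact ⟨F, .refl, ho⟩
  · obtain ⟨σ', hσ⟩ := exists_properExt hF t
    exact ⟨_, .single ⟨t, ⟨hS, hl, ho⟩, σ', hσ, rfl⟩, obsolete_of_properExt hσ⟩

theorem finite_lists {α : Type*} {X : Set α} (hX : X.Finite) (n : ℕ) :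
    {l : List α | l.length = n ∧ ∀ t ∈ l, t ∈ X}.Finite := by
  induction n with
  | zero =>
    refine (Set.finite_singleton []).subset ?_
    rintro l ⟨hl, -⟩
    simpa using hl
  | succ n ih =>
    refine (hX.image2 List.cons ih).subset ?_
    rintro (_ | ⟨a, l⟩) ⟨h1, h2⟩
    · simp at h1
    · exact ⟨a, h2 a (by simp), l, ⟨by simpa using h1, fun t ht => h2 t (by simp [ht])⟩, rfl⟩

/-- The facts over the terms `X` that have the shape of some head atom of `S`. -/
def headFacts (S : RuleSet) (X : Set GroundTerm) : Set Fact :=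
  {f | ∃ r ∈ S, ∃ a ∈ r.2, f.1 = a.1 ∧ f.2.length = a.2.length ∧ ∀ t ∈ f.2, t ∈ X}

theorem finite_headFacts (S : RuleSet) {X : Set GroundTerm} (hX : X.Finite) :
    (headFacts S X).Finite := by
  have : headFacts S X ⊆ ⋃ r ∈ {r | r ∈ S}, ⋃ a ∈ {a | a ∈ r.2},
      ({a.1} ×ˢ {l | l.length = a.2.length ∧ ∀ t ∈ l, t ∈ X}) := by
    rintro ⟨p, l⟩ ⟨r, hr, a, ha, h1, h2⟩
    simp only [Set.mem_iUnion]
    exact ⟨r, hr, a, ha, h1, h2⟩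
  refine Set.Finite.subset ?_ this
  exact (List.finite_toSet S).biUnion fun r _ => (List.finite_toSet r.2).biUnion fun a _ =>
    (Set.finite_singleton _).prod (finite_lists hX _)

theorem IsDatalog.outputOf_subset {S : RuleSet} {t : Trigger} {F : Set Fact} {σ' : ℕ → GroundTerm}
    (hd : IsDatalog t.1) (hS : t.1 ∈ S) (hl : loaded t F) (hσ : agreesOnBody t σ') :
    outputOf t σ' ⊆ headFacts S (termsOf F) := by
  rintro f ⟨a, ha, rfl⟩
  refine ⟨t.1, hS, a, ha, rfl, by simp [applyA], ?_⟩
  intro g hg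
  simp only [applyA, List.mem_map] at hg
  obtain ⟨s, hs, rfl⟩ := hg
  obtain ⟨v, rfl, b, hb, hv⟩ := hd a ha s hs
  refine ⟨_, hl b hb, ?_⟩
  simp only [applyA, List.mem_map]
  exact ⟨_, hv, (hσ v ⟨b, hb, hv⟩).symm⟩

theorem termsOf_union_headFacts (S : RuleSet) {F G : Set Fact} (h : G ⊆ headFacts S (termsOf F)) :
    termsOf (F ∪ G) = termsOf F := by
  ext g
  constructor
  · rintro ⟨f, hf | hf, hg⟩
    · exact ⟨f, hf, hg⟩
    · obtain ⟨r, -, a, -, -, -, h3⟩ := h hf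
      exact h3 g hg
  · rintro ⟨f, hf, hg⟩
    exact ⟨f, Or.inl hf, hg⟩

/-- `F` is closed under the rules of `S`, which are read without existential variables. -/
def ClosedUnder (S : RuleSet) (F : Set Fact) : Prop :=
  ∀ r ∈ S, ∀ σ : ℕ → GroundTerm, loaded (r, σ) F → ∀ a ∈ r.2, applyA σ a ∈ F

theorem ChaseStep.datalog {S : RuleSet} (hS : ∀ r ∈ S, IsDatalog r) {F F' : Set Fact}
    (h : ChaseStep S F F') : F ⊂ F' ∧ F' ⊆ F ∪ headFacts S (termsOf F) ∧
      termsOf F' = termsOf F := by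
  obtain ⟨t, ⟨h1, h2, h3⟩, σ', hσ, rfl⟩ := h
  have hsub := (hS _ h1).outputOf_subset h1 h2 hσ.1
  refine ⟨⟨Set.subset_union_left, fun hsub' => h3 ?_⟩, Set.union_subset_union_right _ hsub,
    termsOf_union_headFacts S hsub⟩
  exact ⟨σ', hσ.1, fun a ha => hsub' (Or.inr ⟨a, ha, rfl⟩)⟩

/-- Datalog saturation of a finite fact set. -/
theorem exists_closedUnder {S : RuleSet} (hS : ∀ r ∈ S, IsDatalog r) {F : Set Fact}
    (hF : F.Finite) : ∃ F', Relation.ReflTransGen (ChaseStep S) F F' ∧ ClosedUnder S F' := by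
  set U := F ∪ headFacts S (termsOf F) with hU
  have hUfin : U.Finite := hF.union (finite_headFacts S (finite_termsOf hF))
  suffices H : ∀ n, ∀ G : Set Fact, G ⊆ U → termsOf G = termsOf F → (U \ G).ncard ≤ n →
      ∃ F', Relation.ReflTransGen (ChaseStep S) G F' ∧ ClosedUnder S F' from
    H _ F Set.subset_union_left rfl le_rfl
  intro n
  induction n with
  | zero =>
    intro G hG hT hn
    refine ⟨G, .refl, ?_⟩
    have hGU : U ⊆ G := by
      have := (Set.ncard_eq_zero (hUfin.sdiff)).1 (Nat.le_zero.1 hn)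
      exact Set.sdiff_eq_empty.1 this
    intro r hr σ hl a ha
    refine hGU (Or.inr ?_)
    rw [← hT]
    exact (hS r hr).outputOf_subset (t := (r, σ)) hr hl (fun _ _ => rfl) ⟨a, ha, rfl⟩
  | succ n ih =>
    intro G hG hT hn
    by_cases hc : ClosedUnder S G
    · exact ⟨G, .refl, hc⟩
    · simp only [ClosedUnder, not_forall] at hc
      obtain ⟨r, hr, σ, hl, a, ha, hna⟩ := hc
      obtain ⟨σ', hσ⟩ := exists_properExt (hUfin.subset hG) (r, σ)
      have hstep : ChaseStep S G (G ∪ outputOf (r, σ) σ') := by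
        refine ⟨(r, σ), ⟨hr, hl, ?_⟩, σ', hσ, rfl⟩
        rintro ⟨τ, h1, h2⟩
        have := h2 a ha
        rw [(hS r hr).applyA_eq h1 ha] at this
        exact hna this
      obtain ⟨h1, h2, h3⟩ := hstep.datalog hS
      have hsub : G ∪ outputOf (r, σ) σ' ⊆ U := by
        refine h2.trans (Set.union_subset hG ?_)
        rw [hT]
        exact Set.subset_union_right
      have hlt : (U \ (G ∪ outputOf (r, σ) σ')).ncard < (U \ G).ncard := by
        refine Set.ncard_lt_ncard ?_ hUfin.sdiff
        refine ⟨Set.sdiff_subset_sdiff_right h1.1, fun hh => h1.2 ?_⟩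
        intro f hf
        by_contra hfG
        exact (hh ⟨hsub hf, hfG⟩).2 hf
      obtain ⟨F', hF', hc'⟩ := ih _ hsub (h3.trans hT) (by omega)
      exact ⟨F', hF'.head hstep, hc'⟩

/-- There is no infinite sequence of Datalog chase steps from a finite fact set. -/
theorem not_forall_datalog_step {S : RuleSet} (hS : ∀ r ∈ S, IsDatalog r) {F : ℕ → Set Fact}
    (hF : (F 0).Finite) : ¬ ∀ i, ChaseStep S (F i) (F (i + 1)) := by
  intro hstep
  have hT : ∀ i, termsOf (F i) = termsOf (F 0) := by
    intro i
    induction i with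
    | zero => rfl
    | succ i ih => exact ((hstep i).datalog hS).2.2.trans ih
  have hsub : ∀ i, F i ⊆ F 0 ∪ headFacts S (termsOf (F 0)) := by
    intro i
    induction i with
    | zero => exact Set.subset_union_left
    | succ i ih =>
      refine ((hstep i).datalog hS).2.1.trans (Set.union_subset ih ?_)
      rw [hT]
      exact Set.subset_union_right
  have hfin := hF.union (finite_headFacts S (finite_termsOf hF))
  have hcard : ∀ i, i ≤ (F i).ncard := by
    intro i
    induction i with
    | zero => exact Nat.zero_le _
    | succ i ih =>
      have := Set.ncard_lt_ncard ((hstep i).datalog hS).1 (hfin.subset (hsub _))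
      omega
  have h1 := hcard ((F 0 ∪ headFacts S (termsOf (F 0))).ncard + 1)
  have h2 := Set.ncard_le_ncard (hsub ((F 0 ∪ headFacts S (termsOf (F 0))).ncard + 1)) hfin
  omega

/-! ### The simulating rule set

Natural numbers are represented by chains of terms. Predicates are coded as follows:
* `0(x)`: `x` is the number zero;
* `1(x, y)`: `y` is the successor of `x` (or `y` is a brake);
* `2(x, w)`: `x` belongs to the number line overseen by the brake `w`;
* `3(x, u, w)`: the brake `w`, created from `u`, is at the node `x`;
* `4(u, w)`: the brake `w` was created from `u`; the brake `w` has been pulled iff `4(w, w)`;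
* `5(w)`: `w` is a brake;
* `6(w, a, b)`: `a < b`, computed on the line of `w`;
* `7(w, a, b, p)`: `Nat.pair a b = p`, computed on the line of `w`;
* `8 + encode c` at `(w, x, y)`: `y ∈ eval c x`, computed on the line of `w`. -/

/-- Extends the number line of a brake. -/
def growRule : Rule := mkRule [(2, [1, 0])] [(1, [1, 2]), (2, [2, 0]), (1, [2, 0]), (3, [2, 0, 0])]

/-- Pulls a brake. -/
def pullRule : Rule :=
  mkRule [(5, [0])] [(4, [0, 0]), (2, [0, 0]), (1, [0, 0]), (3, [0, 0, 0])]

/-- Creates a new brake at a child of the node of the brake `0`; the predicate `g` computes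
the children. -/
def spawnRule (g : ℕ) : Rule :=
  mkRule [(3, [1, 2, 0]), (4, [2, 0]), (2, [3, 0]), (7, [0, 1, 4, 5]), (g, [0, 5, 6]),
      (1, [3, 6]), (2, [6, 0])]
    [(3, [3, 0, 7]), (4, [0, 7]), (2, [3, 7]), (1, [3, 7]), (3, [3, 7, 7]), (5, [7])]

/-- Adds all predecessors of an element of a number line to that line. -/
def copyRule : Rule := mkRule [(2, [2, 0]), (1, [1, 2])] [(2, [1, 0]), (1, [1, 0]), (3, [1, 0, 0])]

/-- Datalog rules for `<` and `Nat.pair`. -/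
def arithRules : List Rule :=
  [mkRule [(1, [1, 2]), (2, [2, 0])] [(6, [0, 1, 2])],
   mkRule [(6, [0, 1, 2]), (1, [2, 3]), (2, [3, 0])] [(6, [0, 1, 3])],
   mkRule [(0, [1]), (2, [1, 0])] [(7, [0, 1, 1, 1])],
   mkRule [(7, [0, 1, 2, 3]), (1, [1, 4]), (2, [4, 0]), (6, [0, 4, 2]), (1, [3, 5]), (2, [5, 0])]
     [(7, [0, 4, 2, 5])],
   mkRule [(7, [0, 1, 2, 3]), (1, [1, 2]), (2, [2, 0]), (0, [4]), (1, [3, 5]), (2, [5, 0])]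
     [(7, [0, 2, 4, 5])],
   mkRule [(7, [0, 1, 2, 3]), (6, [0, 2, 1]), (1, [2, 4]), (2, [4, 0]), (1, [3, 5]), (2, [5, 0])]
     [(7, [0, 1, 4, 5])],
   mkRule [(7, [0, 1, 1, 3]), (1, [1, 2]), (2, [2, 0]), (0, [4]), (1, [3, 5]), (2, [5, 0])]
     [(7, [0, 4, 2, 5])]]

/-- The predicate for the graph of `eval c`. -/
def codePred (c : Code) : ℕ := 8 + Encodable.encode c

/-- Datalog rules that compute the graph of `eval c`. -/
def codeRules : Code → List Rule
  | .zero => [mkRule [(2, [1, 0]), (0, [2]), (2, [2, 0])] [(codePred .zero, [0, 1, 2])]]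
  | .succ => [mkRule [(1, [1, 2]), (2, [2, 0])] [(codePred .succ, [0, 1, 2])]]
  | .left => [mkRule [(7, [0, 1, 2, 3])] [(codePred .left, [0, 3, 1])]]
  | .right => [mkRule [(7, [0, 1, 2, 3])] [(codePred .right, [0, 3, 2])]]
  | .pair f g =>
      mkRule [(codePred f, [0, 1, 2]), (codePred g, [0, 1, 3]), (7, [0, 2, 3, 4])]
        [(codePred (.pair f g), [0, 1, 4])] :: (codeRules f ++ codeRules g)
  | .comp f g =>
      mkRule [(codePred g, [0, 1, 2]), (codePred f, [0, 2, 3])]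
        [(codePred (.comp f g), [0, 1, 3])] :: (codeRules f ++ codeRules g)
  | .prec f g =>
      mkRule [(7, [0, 1, 2, 3]), (0, [2]), (codePred f, [0, 1, 4])]
        [(codePred (.prec f g), [0, 3, 4])] ::
      mkRule [(7, [0, 1, 2, 3]), (codePred (.prec f g), [0, 3, 4]), (1, [2, 5]), (2, [5, 0]),
          (7, [0, 1, 5, 6]), (7, [0, 2, 4, 7]), (7, [0, 1, 7, 8]), (codePred g, [0, 8, 9])]
        [(codePred (.prec f g), [0, 6, 9])] :: (codeRules f ++ codeRules g)
  | .rfind' f =>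
      mkRule [(7, [0, 1, 2, 3]), (codePred f, [0, 3, 4]), (0, [4])]
        [(codePred (.rfind' f), [0, 3, 2])] ::
      mkRule [(7, [0, 1, 2, 3]), (codePred f, [0, 3, 4]), (1, [5, 4]), (2, [4, 0]), (1, [2, 6]),
          (2, [6, 0]), (7, [0, 1, 6, 7]), (codePred (.rfind' f), [0, 7, 8])]
        [(codePred (.rfind' f), [0, 3, 8])] :: codeRules f

/-- The Datalog part of the simulation. -/
def datalogRules (c : Code) : List Rule := copyRule :: (arithRules ++ codeRules c)

/-- The rule set that explores the tree whose child relation is computed by `c`. -/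
def simRules (c : Code) : RuleSet :=
  growRule :: pullRule :: spawnRule (codePred c) :: datalogRules c

/-! ### Soundness of the computation rules -/

/-- The intended meaning of the computation facts on a number line with values `val`. -/
def Sem (val : GroundTerm → ℕ) (p : ℕ) (l : List GroundTerm) : Prop :=
  (p = 6 → ∀ a b, l = [a, b] → val a < val b) ∧
  (p = 7 → ∀ a b q, l = [a, b, q] → Nat.pair (val a) (val b) = val q) ∧
  ∀ c, p = codePred c → ∀ x y, l = [x, y] → val y ∈ eval c (val x)

theorem codePred_injective : Function.Injective codePred := fun c c' h =>
  Encodable.encode_injective (by simpa [codePred] using h)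

theorem le_codePred (c : Code) : 8 ≤ codePred c := Nat.le_add_right _ _

theorem sem_lt {val : GroundTerm → ℕ} {a b : GroundTerm} : Sem val 6 [a, b] ↔ val a < val b := by
  have : ∀ c, (6 = codePred c) = False := fun c => by have := le_codePred c; grind
  simp [Sem, this]

theorem sem_pair {val : GroundTerm → ℕ} {a b q : GroundTerm} :
    Sem val 7 [a, b, q] ↔ Nat.pair (val a) (val b) = val q := by
  have : ∀ c, (7 = codePred c) = False := fun c => by have := le_codePred c; grind
  simp [Sem, this]

theorem sem_code {val : GroundTerm → ℕ} {c : Code} {x y : GroundTerm} :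
    Sem val (codePred c) [x, y] ↔ val y ∈ eval c (val x) := by
  have h := le_codePred c
  have h6 : (codePred c = 6) = False := by grind
  have h7 : (codePred c = 7) = False := by grind
  simp only [Sem, h6, h7, codePred_injective.eq_iff]
  constructor
  · exact fun H => H.2.2 c rfl x y rfl
  · rintro H
    refine ⟨False.elim, False.elim, ?_⟩
    rintro _ rfl _ _ h
    simp only [List.cons.injEq, and_true] at h
    obtain ⟨rfl, rfl⟩ := h
    exact H

/-- On the line of `w`, all facts have their intended meaning. -/
structure SoundLine (F : Set Fact) (val : GroundTerm → ℕ) (w : GroundTerm) : Prop where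
  zero : ∀ {x}, ((0, [x]) : Fact) ∈ F → val x = 0
  succ : ∀ {x y}, ((1, [x, y]) : Fact) ∈ F → ((2, [y, w]) : Fact) ∈ F → val y = val x + 1
  sem : ∀ p l, 6 ≤ p → ((p, w :: l) : Fact) ∈ F → Sem val p l

/-- Sound Datalog rules whose head is a single computation fact. -/
def IsComputationRule (r : Rule) : Prop :=
  ∃ b p vs, r = mkRule b [(p, 0 :: vs)] ∧ 6 ≤ p ∧ (∀ v ∈ 0 :: vs, ∃ q ∈ b, v ∈ q.2) ∧
    ∀ F val σ, SoundLine F val (σ 0) → (∀ q ∈ b, ((q.1, q.2.map σ) : Fact) ∈ F) →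
      Sem val p (vs.map σ)

theorem IsComputationRule.isDatalog {r : Rule} (h : IsComputationRule r) : IsDatalog r := by
  obtain ⟨b, p, vs, rfl, -, h, -⟩ := h
  exact isDatalog_mkRule (by simpa using h)

section SoundLine

variable {F : Set Fact} {val : GroundTerm → ℕ} {w : GroundTerm}

theorem SoundLine.lt (h : SoundLine F val w) {a b : GroundTerm}
    (hf : ((6, [w, a, b]) : Fact) ∈ F) : val a < val b := sem_lt.1 (h.sem _ _ le_rfl hf)

theorem SoundLine.pair (h : SoundLine F val w) {a b p : GroundTerm}
    (hf : ((7, [w, a, b, p]) : Fact) ∈ F) : Nat.pair (val a) (val b) = val p :=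
  sem_pair.1 (h.sem _ _ (by omega) hf)

theorem SoundLine.code (h : SoundLine F val w) {c : Code} {x y : GroundTerm}
    (hf : ((codePred c, [w, x, y]) : Fact) ∈ F) : val y ∈ eval c (val x) :=
  sem_code.1 (h.sem _ _ ((le_codePred c).trans' (by omega)) hf)

end SoundLine

theorem pair_succ_left {a b : ℕ} (h : a + 1 < b) : Nat.pair (a + 1) b = Nat.pair a b + 1 := by
  simp only [Nat.pair, h, if_true, (by omega : a < b)]; omega

theorem pair_succ_zero (a : ℕ) : Nat.pair (a + 1) 0 = Nat.pair a (a + 1) + 1 := by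
  simp [Nat.pair]; ring

theorem pair_succ_right {a b : ℕ} (h : b < a) : Nat.pair a (b + 1) = Nat.pair a b + 1 := by
  rw [Nat.pair, Nat.pair, if_neg (by omega), if_neg (by omega)]; omega

theorem pair_zero_succ (a : ℕ) : Nat.pair 0 (a + 1) = Nat.pair a a + 1 := by
  simp [Nat.pair]; ring

theorem isComputationRule_arith {r : Rule} (hr : r ∈ arithRules) : IsComputationRule r := by
  simp only [arithRules, List.mem_cons, List.not_mem_nil, or_false] at hr
  rcases hr with rfl | rfl | rfl | rfl | rfl | rfl | rfl
  all_goals refine ⟨_, _, _, rfl, by omega, by simp, ?_⟩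
  all_goals
    intro F val σ hc h
    simp only [List.mem_cons, List.not_mem_nil, or_false, forall_eq_or_imp, forall_eq,
      List.map_cons, List.map_nil] at h
    simp only [List.map_cons, List.map_nil, sem_lt, sem_pair]
  · have := hc.succ h.1 h.2
    omega
  · obtain ⟨h1, h2, h3⟩ := h
    have := hc.lt h1
    have := hc.succ h2 h3
    omega
  · simp [hc.zero h.1, Nat.pair]
  · obtain ⟨h1, h2, h3, h4, h5, h6⟩ := h
    have e1 := hc.succ h2 h3
    have e2 := hc.lt h4
    rw [hc.succ h5 h6, ← hc.pair h1, e1, pair_succ_left (by omega)]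
  · obtain ⟨h1, h2, h3, h4, h5, h6⟩ := h
    rw [hc.succ h5 h6, ← hc.pair h1, hc.succ h2 h3, hc.zero h4, pair_succ_zero]
  · obtain ⟨h1, h2, h3, h4, h5, h6⟩ := h
    rw [hc.succ h5 h6, ← hc.pair h1, hc.succ h3 h4, pair_succ_right (hc.lt h2)]
  · obtain ⟨h1, h2, h3, h4, h5, h6⟩ := h
    rw [hc.succ h5 h6, ← hc.pair h1, hc.succ h2 h3, hc.zero h4, pair_zero_succ]

theorem mem_eval_rfind' {f : Code} {a m r : ℕ} : r ∈ eval (.rfind' f) (Nat.pair a m) ↔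
    ∃ n, r = n + m ∧ 0 ∈ eval f (Nat.pair a (n + m)) ∧
      ∀ k < n, ∃ y, y + 1 ∈ eval f (Nat.pair a (k + m)) := by
  simp only [eval, Nat.unpaired, Nat.unpair_pair, Part.map_eq_map, Part.mem_map_iff]
  constructor
  · rintro ⟨n, hn, rfl⟩
    obtain ⟨h0, h⟩ := Nat.mem_rfind.1 hn
    refine ⟨n, rfl, ?_, fun k hk => ?_⟩
    · obtain ⟨y, hy, h0⟩ := (Part.mem_map_iff _).1 h0
      obtain rfl : y = 0 := by simpa using h0
      exact hy
    · obtain ⟨z, hz, h1⟩ := (Part.mem_map_iff _).1 (h hk)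
      obtain ⟨z, rfl⟩ := Nat.exists_eq_succ_of_ne_zero (n := z) (by simpa using h1)
      exact ⟨z, hz⟩
  · rintro ⟨n, rfl, h0, h⟩
    refine ⟨n, Nat.mem_rfind.2 ⟨(Part.mem_map_iff _).2 ⟨0, h0, by simp⟩, fun {k} hk => ?_⟩, rfl⟩
    obtain ⟨y, hy⟩ := h k hk
    exact (Part.mem_map_iff _).2 ⟨y + 1, hy, by simp⟩

theorem mem_eval_rfind'_zero {f : Code} {a m : ℕ} (h : 0 ∈ eval f (Nat.pair a m)) :
    m ∈ eval (.rfind' f) (Nat.pair a m) :=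
  mem_eval_rfind'.2 ⟨0, by simp, by simpa using h, by simp⟩

theorem mem_eval_rfind'_succ {f : Code} {a m y r : ℕ} (h : y + 1 ∈ eval f (Nat.pair a m))
    (hr : r ∈ eval (.rfind' f) (Nat.pair a (m + 1))) : r ∈ eval (.rfind' f) (Nat.pair a m) := by
  obtain ⟨n, rfl, h0, hk⟩ := mem_eval_rfind'.1 hr
  refine mem_eval_rfind'.2 ⟨n + 1, by ring, by rwa [show n + 1 + m = n + (m + 1) by ring], ?_⟩
  rintro (_ | k) hkn
  · exact ⟨y, by simpa using h⟩
  · rw [show k + 1 + m = k + (m + 1) by ring]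
    exact hk k (by omega)

theorem mem_eval_pair {f g : Code} {x y : ℕ} : y ∈ eval (.pair f g) x ↔
    ∃ a ∈ eval f x, ∃ b ∈ eval g x, Nat.pair a b = y := by
  simp [eval, Seq.seq]

theorem mem_eval_comp {f g : Code} {x y : ℕ} : y ∈ eval (.comp f g) x ↔
    ∃ a ∈ eval g x, y ∈ eval f a := Part.mem_bind_iff

theorem mem_eval_prec_succ {f g : Code} {a k y : ℕ} :
    y ∈ eval (.prec f g) (Nat.pair a (k + 1)) ↔
    ∃ i ∈ eval (.prec f g) (Nat.pair a k), y ∈ eval g (Nat.pair a (Nat.pair k i)) := by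
  rw [← Nat.succ_eq_add_one, eval_prec_succ]
  simp

theorem isComputationRule_code (c : Code) : ∀ r ∈ codeRules c, IsComputationRule r := by
  have hle : ∀ c, 6 ≤ codePred c := fun c => (le_codePred c).trans' (by omega)
  induction c with
  | zero =>
    simp only [codeRules, List.mem_singleton, forall_eq]
    refine ⟨_, _, _, rfl, hle _, by simp, fun F val σ hc h => ?_⟩
    simp at h
    simp only [List.map_cons, List.map_nil, sem_code, hc.zero h.2.1]
    exact Part.mem_some 0
  | succ =>
    simp only [codeRules, List.mem_singleton, forall_eq]
    refine ⟨_, _, _, rfl, hle _, by simp, fun F val σ hc h => ?_⟩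
    simp at h
    simp [sem_code, eval, hc.succ h.1 h.2]
  | left =>
    simp only [codeRules, List.mem_singleton, forall_eq]
    refine ⟨_, _, _, rfl, hle _, by simp, fun F val σ hc h => ?_⟩
    simp at h
    simp [sem_code, eval, ← hc.pair h]
  | right =>
    simp only [codeRules, List.mem_singleton, forall_eq]
    refine ⟨_, _, _, rfl, hle _, by simp, fun F val σ hc h => ?_⟩
    simp at h
    simp [sem_code, eval, ← hc.pair h]
  | pair f g ihf ihg =>
    simp only [codeRules, List.mem_cons, List.mem_append]
    rintro r (rfl | hr | hr)
    · refine ⟨_, _, _, rfl, hle _, by simp, fun F val σ hc h => ?_⟩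
      simp only [List.mem_cons, List.not_mem_nil, or_false, forall_eq_or_imp, forall_eq,
        List.map_cons, List.map_nil] at h
      obtain ⟨h1, h2, h3⟩ := h
      exact sem_code.2 (mem_eval_pair.2 ⟨_, hc.code h1, _, hc.code h2, hc.pair h3⟩)
    · exact ihf r hr
    · exact ihg r hr
  | comp f g ihf ihg =>
    simp only [codeRules, List.mem_cons, List.mem_append]
    rintro r (rfl | hr | hr)
    · refine ⟨_, _, _, rfl, hle _, by simp, fun F val σ hc h => ?_⟩
      simp only [List.mem_cons, List.not_mem_nil, or_false, forall_eq_or_imp, forall_eq,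
        List.map_cons, List.map_nil] at h
      exact sem_code.2 (mem_eval_comp.2 ⟨_, hc.code h.1, hc.code h.2⟩)
    · exact ihf r hr
    · exact ihg r hr
  | prec f g ihf ihg =>
    simp only [codeRules, List.mem_cons, List.mem_append]
    rintro r (rfl | rfl | hr | hr)
    · refine ⟨_, _, _, rfl, hle _, by simp, fun F val σ hc h => ?_⟩
      simp only [List.mem_cons, List.not_mem_nil, or_false, forall_eq_or_imp, forall_eq,
        List.map_cons, List.map_nil] at h
      obtain ⟨h1, h2, h3⟩ := h
      refine sem_code.2 ?_
      rw [← hc.pair h1, hc.zero h2, eval_prec_zero]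
      exact hc.code h3
    · refine ⟨_, _, _, rfl, hle _, by simp, fun F val σ hc h => ?_⟩
      simp only [List.mem_cons, List.not_mem_nil, or_false, forall_eq_or_imp, forall_eq,
        List.map_cons, List.map_nil] at h
      obtain ⟨h1, h2, h3, h4, h5, h6, h7, h8⟩ := h
      refine sem_code.2 ?_
      rw [← hc.pair h5, hc.succ h3 h4]
      refine mem_eval_prec_succ.2 ⟨val (σ 4), ?_, ?_⟩
      · rw [hc.pair h1]
        exact hc.code h2
      · rw [hc.pair h6, hc.pair h7]
        exact hc.code h8
    · exact ihf r hr
    · exact ihg r hr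
  | rfind' f ihf =>
    simp only [codeRules, List.mem_cons]
    rintro r (rfl | rfl | hr)
    · refine ⟨_, _, _, rfl, hle _, by simp, fun F val σ hc h => ?_⟩
      simp only [List.mem_cons, List.not_mem_nil, or_false, forall_eq_or_imp, forall_eq,
        List.map_cons, List.map_nil] at h
      obtain ⟨h1, h2, h3⟩ := h
      refine sem_code.2 ?_
      rw [← hc.pair h1]
      refine mem_eval_rfind'_zero ?_
      rw [hc.pair h1, ← hc.zero h3]
      exact hc.code h2
    · refine ⟨_, _, _, rfl, hle _, by simp, fun F val σ hc h => ?_⟩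
      simp only [List.mem_cons, List.not_mem_nil, or_false, forall_eq_or_imp, forall_eq,
        List.map_cons, List.map_nil] at h
      obtain ⟨h1, h2, h3, h4, h5, h6, h7, h8⟩ := h
      refine sem_code.2 ?_
      rw [← hc.pair h1]
      refine mem_eval_rfind'_succ (y := val (σ 5)) ?_ ?_
      · rw [hc.pair h1, ← hc.succ h3 h4]
        exact hc.code h2
      · rw [← hc.succ h5 h6, hc.pair h7]
        exact hc.code h8
    · exact ihf r hr

theorem isDatalog_of_mem_datalogRules {c : Code} : ∀ r ∈ datalogRules c, IsDatalog r := by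
  simp only [datalogRules, List.mem_cons, List.mem_append]
  rintro r (rfl | hr | hr)
  · exact isDatalog_mkRule (by simp)
  · exact (isComputationRule_arith hr).isDatalog
  · exact (isComputationRule_code c r hr).isDatalog

theorem isDatalog_pullRule : IsDatalog pullRule := isDatalog_mkRule (by simp)

/-! ### Completeness of the computation rules -/

/-- `e 0, …, e N` is a number line overseen by `w`. -/
structure ChainIn (F : Set Fact) (w : GroundTerm) (e : ℕ → GroundTerm) (N : ℕ) : Prop where
  zero : ((0, [e 0]) : Fact) ∈ F
  line : ∀ n ≤ N, ((2, [e n, w]) : Fact) ∈ F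
  succ : ∀ n < N, ((1, [e n, e (n + 1)]) : Fact) ∈ F

theorem ClosedUnder.mono {S S' : RuleSet} (hS : S ⊆ S') {F : Set Fact} (h : ClosedUnder S' F) :
    ClosedUnder S F := fun r hr => h r (hS hr)

theorem ClosedUnder.mem {S : RuleSet} {F : Set Fact} (h : ClosedUnder S F)
    {b hd : List (ℕ × List ℕ)} (hr : mkRule b hd ∈ S) (l : List GroundTerm)
    (hb : ∀ q ∈ b, ((q.1, q.2.map fun i => l.getD i (Sum.inl 0)) : Fact) ∈ F) :
    ∀ q ∈ hd, ((q.1, q.2.map fun i => l.getD i (Sum.inl 0)) : Fact) ∈ F := by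
  intro q hq
  have := h _ hr (fun i => l.getD i (Sum.inl 0)) (loaded_mkRule.2 hb) (varAtom q)
    (List.mem_map.2 ⟨q, hq, rfl⟩)
  rwa [applyA_varAtom] at this

section Complete

variable {F : Set Fact} {w : GroundTerm} {e : ℕ → GroundTerm} {N : ℕ}

theorem ChainIn.lt (hF : ClosedUnder arithRules F) (hc : ChainIn F w e N) {a b : ℕ} (hab : a < b)
    (hb : b ≤ N) : ((6, [w, e a, e b]) : Fact) ∈ F := by
  induction b with
  | zero => omega
  | succ b ih =>
    rcases Nat.lt_succ_iff_lt_or_eq.1 hab with h | rfl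
    · simpa using hF.mem (b := [(6, [0, 1, 2]), (1, [2, 3]), (2, [3, 0])]) (hd := [(6, [0, 1, 3])])
        (by simp [arithRules]) [w, e a, e b, e (b + 1)]
        (by simp [ih h (by omega), hc.succ b (by omega), hc.line (b + 1) hb])
    · simpa using hF.mem (b := [(1, [1, 2]), (2, [2, 0])]) (hd := [(6, [0, 1, 2])])
        (by simp [arithRules]) [w, e a, e (a + 1)]
        (by simp [hc.succ a (by omega), hc.line (a + 1) hb])

theorem ChainIn.unpair (hF : ClosedUnder arithRules F) (hc : ChainIn F w e N) {p : ℕ}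
    (hp : p ≤ N) : ((7, [w, e p.unpair.1, e p.unpair.2, e p]) : Fact) ∈ F := by
  induction p with
  | zero =>
    simpa using hF.mem (b := [(0, [1]), (2, [1, 0])]) (hd := [(7, [0, 1, 1, 1])])
      (by simp [arithRules]) [w, e 0] (by simp [hc.zero, hc.line 0 (by omega)])
  | succ p ih =>
    have ih := ih (by omega)
    have hsp := hc.succ p (by omega)
    have hlp := hc.line (p + 1) hp
    obtain ⟨a, b, hpab⟩ : ∃ a b, p = Nat.pair a b := ⟨_, _, (Nat.pair_unpair p).symm⟩
    have ha : a ≤ p := hpab ▸ Nat.left_le_pair a b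
    have hb : b ≤ p := hpab ▸ Nat.right_le_pair a b
    have hu : Nat.unpair p = (a, b) := by rw [hpab, Nat.unpair_pair]
    rw [hu] at ih
    have key : ∀ a' b', Nat.pair a' b' = Nat.pair a b + 1 → Nat.unpair (p + 1) = (a', b') := by
      intro a' b' h
      rw [hpab, ← h, Nat.unpair_pair]
    rcases lt_trichotomy a b with h | rfl | h
    · rcases Nat.lt_or_ge (a + 1) b with h' | h'
      · rw [key _ _ (pair_succ_left h')]
        simpa using hF.mem (b := [(7, [0, 1, 2, 3]), (1, [1, 4]), (2, [4, 0]), (6, [0, 4, 2]),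
          (1, [3, 5]), (2, [5, 0])]) (hd := [(7, [0, 4, 2, 5])]) (by simp [arithRules])
          [w, e a, e b, e p, e (a + 1), e (p + 1)]
          (by simp [ih, hsp, hlp, hc.succ a (by omega), hc.line (a + 1) (by omega),
            hc.lt hF h' (by omega)])
      · obtain rfl : b = a + 1 := by omega
        rw [key _ _ (pair_succ_zero a)]
        simpa using hF.mem (b := [(7, [0, 1, 2, 3]), (1, [1, 2]), (2, [2, 0]), (0, [4]), (1, [3, 5]),
          (2, [5, 0])]) (hd := [(7, [0, 2, 4, 5])]) (by simp [arithRules])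
          [w, e a, e (a + 1), e p, e 0, e (p + 1)]
          (by simp [ih, hsp, hlp, hc.succ a (by omega), hc.line (a + 1) (by omega), hc.zero])
    · rw [key _ _ (pair_zero_succ a)]
      simpa using hF.mem (b := [(7, [0, 1, 1, 3]), (1, [1, 2]), (2, [2, 0]), (0, [4]), (1, [3, 5]),
        (2, [5, 0])]) (hd := [(7, [0, 4, 2, 5])]) (by simp [arithRules])
        [w, e a, e (a + 1), e p, e 0, e (p + 1)]
        (by simp [ih, hsp, hlp, hc.succ a (by omega), hc.line (a + 1) (by omega), hc.zero])
    · rw [key _ _ (pair_succ_right h)]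
      simpa using hF.mem (b := [(7, [0, 1, 2, 3]), (6, [0, 2, 1]), (1, [2, 4]), (2, [4, 0]),
        (1, [3, 5]), (2, [5, 0])]) (hd := [(7, [0, 1, 4, 5])]) (by simp [arithRules])
        [w, e a, e b, e p, e (b + 1), e (p + 1)]
        (by simp [ih, hsp, hlp, hc.succ b (by omega), hc.line (b + 1) (by omega),
          hc.lt hF h (by omega)])

theorem ChainIn.pair (hF : ClosedUnder arithRules F) (hc : ChainIn F w e N) {a b : ℕ}
    (hp : Nat.pair a b ≤ N) : ((7, [w, e a, e b, e (Nat.pair a b)]) : Fact) ∈ F := by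
  simpa using hc.unpair hF hp

end Complete

/-- The fact `y ∈ eval c x` is derived on every sufficiently long number line. -/
def Derivable (S : RuleSet) (c : Code) (x y : ℕ) : Prop :=
  ∃ N₀, ∀ F w e N, ClosedUnder (arithRules ++ S) F → ChainIn F w e N → N₀ ≤ N →
    ((codePred c, [w, e x, e y]) : Fact) ∈ F

theorem Derivable.mono {S S' : RuleSet} (hS : S ⊆ S') {c : Code} {x y : ℕ}
    (h : Derivable S c x y) : Derivable S' c x y := by
  obtain ⟨N₀, h⟩ := h
  refine ⟨N₀, fun F w e N hF => h F w e N (hF.mono ?_)⟩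
  exact List.append_subset.2 ⟨List.subset_append_left _ _,
    List.Subset.trans hS (List.subset_append_right _ _)⟩

theorem derivable_of_mem_eval (c : Code) :
    ∀ x y, y ∈ eval c x → Derivable (codeRules c) c x y := by
  have harith : ∀ {S : RuleSet} {F : Set Fact}, ClosedUnder (arithRules ++ S) F →
      ClosedUnder arithRules F := fun h => h.mono (List.subset_append_left _ _)
  induction c with
  | zero =>
    intro x y hy
    obtain rfl : y = 0 := Part.mem_some_iff.1 hy
    refine ⟨x, fun F w e N hF hc hN => ?_⟩
    simpa using hF.mem (b := [(2, [1, 0]), (0, [2]), (2, [2, 0])])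
      (hd := [(codePred .zero, [0, 1, 2])])
      (by simp [codeRules]) [w, e x, e 0]
      (by simp [hc.zero, hc.line x hN, hc.line 0 (Nat.zero_le _)])
  | succ =>
    intro x y hy
    obtain rfl : y = x + 1 := by simpa [eval] using hy
    refine ⟨x + 1, fun F w e N hF hc hN => ?_⟩
    simpa using hF.mem (b := [(1, [1, 2]), (2, [2, 0])]) (hd := [(codePred .succ, [0, 1, 2])])
      (by simp [codeRules]) [w, e x, e (x + 1)]
      (by simp [hc.succ x (by omega), hc.line (x + 1) hN])
  | left =>
    intro x y hy
    obtain rfl : y = x.unpair.1 := by simpa [eval] using hy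
    refine ⟨x, fun F w e N hF hc hN => ?_⟩
    simpa using hF.mem (b := [(7, [0, 1, 2, 3])]) (hd := [(codePred .left, [0, 3, 1])])
      (by simp [codeRules]) [w, e x.unpair.1, e x.unpair.2, e x]
      (by simp [hc.unpair (harith hF) hN])
  | right =>
    intro x y hy
    obtain rfl : y = x.unpair.2 := by simpa [eval] using hy
    refine ⟨x, fun F w e N hF hc hN => ?_⟩
    simpa using hF.mem (b := [(7, [0, 1, 2, 3])]) (hd := [(codePred .right, [0, 3, 2])])
      (by simp [codeRules]) [w, e x.unpair.1, e x.unpair.2, e x]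
      (by simp [hc.unpair (harith hF) hN])
  | pair f g ihf ihg =>
    intro x y hy
    obtain ⟨a, ha, b, hb, rfl⟩ := mem_eval_pair.1 hy
    obtain ⟨N₁, h₁⟩ := (ihf x a ha).mono (S' := codeRules (.pair f g))
          (fun r hr => by simp [codeRules, hr])
    obtain ⟨N₂, h₂⟩ := (ihg x b hb).mono (S' := codeRules (.pair f g))
          (fun r hr => by simp [codeRules, hr])
    refine ⟨N₁ + N₂ + Nat.pair a b, fun F w e N hF hc hN => ?_⟩
    simpa using hF.mem (b := [(codePred f, [0, 1, 2]), (codePred g, [0, 1, 3]), (7, [0, 2, 3, 4])])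
      (hd := [(codePred (.pair f g), [0, 1, 4])])
      (by simp [codeRules]) [w, e x, e a, e b, e (Nat.pair a b)]
      (by simp [h₁ F w e N hF hc (by omega), h₂ F w e N hF hc (by omega),
        hc.pair (harith hF) (a := a) (b := b) (by omega)])
  | comp f g ihf ihg =>
    intro x y hy
    obtain ⟨a, ha, hb⟩ := mem_eval_comp.1 hy
    obtain ⟨N₁, h₁⟩ := (ihf a y hb).mono (S' := codeRules (.comp f g))
          (fun r hr => by simp [codeRules, hr])
    obtain ⟨N₂, h₂⟩ := (ihg x a ha).mono (S' := codeRules (.comp f g))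
          (fun r hr => by simp [codeRules, hr])
    refine ⟨N₁ + N₂, fun F w e N hF hc hN => ?_⟩
    simpa using hF.mem (b := [(codePred g, [0, 1, 2]), (codePred f, [0, 2, 3])])
      (hd := [(codePred (.comp f g), [0, 1, 3])])
      (by simp [codeRules]) [w, e x, e a, e y]
      (by simp [h₁ F w e N hF hc (by omega), h₂ F w e N hF hc (by omega)])
  | prec f g ihf ihg =>
    intro x
    obtain ⟨a, n, rfl⟩ : ∃ a n, x = Nat.pair a n := ⟨_, _, (Nat.pair_unpair x).symm⟩
    induction n with
    | zero =>
      intro y hy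
      rw [eval_prec_zero] at hy
      obtain ⟨N₁, h₁⟩ := (ihf a y hy).mono (S' := codeRules (.prec f g))
          (fun r hr => by simp [codeRules, hr])
      refine ⟨N₁ + Nat.pair a 0, fun F w e N hF hc hN => ?_⟩
      simpa using hF.mem (b := [(7, [0, 1, 2, 3]), (0, [2]), (codePred f, [0, 1, 4])])
        (hd := [(codePred (.prec f g), [0, 3, 4])])
        (by simp [codeRules]) [w, e a, e 0, e (Nat.pair a 0), e y]
        (by simp [h₁ F w e N hF hc (by omega), hc.zero,
          hc.pair (harith hF) (a := a) (b := 0) (by omega)])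
    | succ k ih =>
      intro y hy
      obtain ⟨i, hi, hy⟩ := mem_eval_prec_succ.1 hy
      obtain ⟨N₁, h₁⟩ := ih i hi
      obtain ⟨N₂, h₂⟩ := (ihg _ y hy).mono (S' := codeRules (.prec f g))
          (fun r hr => by simp [codeRules, hr])
      refine ⟨N₁ + N₂ + Nat.pair a k + Nat.pair a (k + 1) + Nat.pair k i +
        Nat.pair a (Nat.pair k i), fun F w e N hF hc hN => ?_⟩
      have hk := Nat.right_le_pair a (k + 1)
      simpa using hF.mem (b := [(7, [0, 1, 2, 3]), (codePred (.prec f g), [0, 3, 4]), (1, [2, 5]),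
          (2, [5, 0]), (7, [0, 1, 5, 6]), (7, [0, 2, 4, 7]), (7, [0, 1, 7, 8]),
          (codePred g, [0, 8, 9])])
        (hd := [(codePred (.prec f g), [0, 6, 9])])
        (by simp [codeRules]) [w, e a, e k, e (Nat.pair a k), e i, e (k + 1),
          e (Nat.pair a (k + 1)), e (Nat.pair k i), e (Nat.pair a (Nat.pair k i)), e y]
        (by simp [h₁ F w e N hF hc (by omega), h₂ F w e N hF hc (by omega),
          hc.pair (harith hF) (a := a) (b := k) (by omega),
          hc.pair (harith hF) (a := a) (b := k + 1) (by omega),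
          hc.pair (harith hF) (a := k) (b := i) (by omega),
          hc.pair (harith hF) (a := a) (b := Nat.pair k i) (by omega),
          hc.succ k (by omega), hc.line (k + 1) (by omega)])
  | rfind' f ihf =>
    intro x y hy
    obtain ⟨a, m, rfl⟩ : ∃ a n, x = Nat.pair a n := ⟨_, _, (Nat.pair_unpair x).symm⟩
    obtain ⟨n, rfl, h0, hpos⟩ := mem_eval_rfind'.1 hy
    clear hy
    induction n generalizing m with
    | zero =>
      simp only [Nat.zero_add] at h0 ⊢
      obtain ⟨N₁, h₁⟩ := (ihf _ 0 h0).mono (S' := codeRules (.rfind' f))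
          (fun r hr => by simp [codeRules, hr])
      refine ⟨N₁ + Nat.pair a m, fun F w e N hF hc hN => ?_⟩
      simpa using hF.mem (b := [(7, [0, 1, 2, 3]), (codePred f, [0, 3, 4]), (0, [4])])
        (hd := [(codePred (.rfind' f), [0, 3, 2])])
        (by simp [codeRules]) [w, e a, e m, e (Nat.pair a m), e 0]
        (by simp [h₁ F w e N hF hc (by omega), hc.zero,
          hc.pair (harith hF) (a := a) (b := m) (by omega)])
    | succ n ih =>
      rw [show n + 1 + m = n + (m + 1) by ring] at h0 ⊢
      obtain ⟨N₁, h₁⟩ := ih (m + 1) h0 fun k hk => by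
        rw [show k + (m + 1) = k + 1 + m by ring]
        exact hpos (k + 1) (by omega)
      obtain ⟨z, hz⟩ := hpos 0 (by omega)
      simp only [Nat.zero_add] at hz
      obtain ⟨N₂, h₂⟩ := (ihf _ _ hz).mono (S' := codeRules (.rfind' f))
          (fun r hr => by simp [codeRules, hr])
      refine ⟨N₁ + N₂ + Nat.pair a m + Nat.pair a (m + 1) + (z + 1),
        fun F w e N hF hc hN => ?_⟩
      have hk := Nat.right_le_pair a (m + 1)
      simpa using hF.mem (b := [(7, [0, 1, 2, 3]), (codePred f, [0, 3, 4]), (1, [5, 4]), (2, [4, 0]),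
          (1, [2, 6]), (2, [6, 0]), (7, [0, 1, 6, 7]), (codePred (.rfind' f), [0, 7, 8])])
        (hd := [(codePred (.rfind' f), [0, 3, 8])])
        (by simp [codeRules]) [w, e a, e m, e (Nat.pair a m), e (z + 1), e z, e (m + 1),
          e (Nat.pair a (m + 1)), e (n + (m + 1))]
        (by simp [h₁ F w e N hF hc (by omega), h₂ F w e N hF hc (by omega),
          hc.pair (harith hF) (a := a) (b := m) (by omega),
          hc.pair (harith hF) (a := a) (b := m + 1) (by omega),
          hc.succ z (by omega), hc.line (z + 1) (by omega),
          hc.succ m (by omega), hc.line (m + 1) (by omega)])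

/-! ### Analysis of the chase steps of the simulating rule set -/

theorem notMem_of_fresh {F : Set Fact} {y : GroundTerm} (hy : y ∉ termsOf F) {p : ℕ}
    {l : List GroundTerm} (hf : ((p, l) : Fact) ∈ F) : y ∉ l := fun h => hy ⟨_, hf, h⟩

/-- Members of number lines are attached to their brake, and pulled brakes are saturated. -/
structure BrakeInv (F : Set Fact) : Prop where
  line : ∀ {x w}, ((2, [x, w]) : Fact) ∈ F →
    ((1, [x, w]) : Fact) ∈ F ∧ ((3, [x, w, w]) : Fact) ∈ F ∧ ((5, [w]) : Fact) ∈ F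
  pulled : ∀ {w}, ((4, [w, w]) : Fact) ∈ F → ((2, [w, w]) : Fact) ∈ F

/-- The chase steps with the rules `growRule` and `spawnRule (codePred c)`, for the brake `w`. -/
inductive ExStep (c : Code) (F : Set Fact) (w : GroundTerm) : Set Fact → Prop
  | grow {x y : GroundTerm} (hx : ((2, [x, w]) : Fact) ∈ F) (hw : ((4, [w, w]) : Fact) ∉ F)
      (hy : y ∉ termsOf F) :
      ExStep c F w (F ∪ {(1, [x, y]), (2, [y, w]), (1, [y, w]), (3, [y, w, w])})
  | spawn {a u b n p y v : GroundTerm} (h1 : ((3, [a, u, w]) : Fact) ∈ F)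
      (h2 : ((4, [u, w]) : Fact) ∈ F) (h3 : ((2, [b, w]) : Fact) ∈ F)
      (h4 : ((7, [w, a, n, p]) : Fact) ∈ F) (h5 : ((codePred c, [w, p, y]) : Fact) ∈ F)
      (h6 : ((1, [b, y]) : Fact) ∈ F) (h7 : ((2, [y, w]) : Fact) ∈ F)
      (hw : ((4, [w, w]) : Fact) ∉ F) (hv : v ∉ termsOf F) :
      ExStep c F w (F ∪ {(3, [b, w, v]), (4, [w, v]), (2, [b, v]), (1, [b, v]), (3, [b, v, v]),
        (5, [v])})

/-- The chase steps with Datalog rules. -/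
inductive DatalogStep (F : Set Fact) : Set Fact → Prop
  | pull {w : GroundTerm} (hw : ((5, [w]) : Fact) ∈ F) :
      DatalogStep F (F ∪ {(4, [w, w]), (2, [w, w]), (1, [w, w]), (3, [w, w, w])})
  | copy {x y w : GroundTerm} (hy : ((2, [y, w]) : Fact) ∈ F) (hxy : ((1, [x, y]) : Fact) ∈ F) :
      DatalogStep F (F ∪ {(2, [x, w]), (1, [x, w]), (3, [x, w, w])})
  | compute {p : ℕ} {w : GroundTerm} {l : List GroundTerm} (hp : 6 ≤ p)
      (hl : ∀ val, SoundLine F val w → Sem val p l) : DatalogStep F (F ∪ {(p, w :: l)})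

theorem mem_simRules {c : Code} {r : Rule} : r ∈ simRules c ↔
    r = growRule ∨ r = spawnRule (codePred c) ∨ r ∈ pullRule :: datalogRules c := by
  simp only [simRules, List.mem_cons]
  tauto

theorem outputOf_mkRule_eq {b h : List (ℕ × List ℕ)} {σ σ' : ℕ → GroundTerm} :
    outputOf (mkRule b h, σ) σ' = {f | f ∈ h.map fun q => ((q.1, q.2.map σ') : Fact)} := by
  ext f
  rw [mem_outputOf_mkRule]
  simp [eq_comm]

theorem BrakeInv.obsolete_growRule {F : Set Fact} (hF : BrakeInv F) {σ : ℕ → GroundTerm}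
    (hl : loaded (growRule, σ) F) (hw : ((4, [σ 0, σ 0]) : Fact) ∈ F) :
    obsolete (growRule, σ) F := by
  have h1 := loaded_mkRule.1 hl
  simp only [List.mem_singleton, forall_eq, List.map_cons, List.map_nil] at h1
  have h2 := hF.pulled hw
  refine obsolete_mkRule.2 ⟨Function.update σ 2 (σ 0), by simp, ?_⟩
  simp [hF.line h1, hF.line h2, h2]

theorem BrakeInv.obsolete_spawnRule {F : Set Fact} (hF : BrakeInv F) {g : ℕ} {σ : ℕ → GroundTerm}
    (hl : loaded (spawnRule g, σ) F) (hw : ((4, [σ 0, σ 0]) : Fact) ∈ F) :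
    obsolete (spawnRule g, σ) F := by
  have h1 := loaded_mkRule.1 hl
  simp only [List.mem_cons, List.not_mem_nil, or_false, forall_eq_or_imp, forall_eq,
    List.map_cons, List.map_nil] at h1
  refine obsolete_mkRule.2 ⟨Function.update σ 7 (σ 0), by simp, ?_⟩
  simp [hF.line h1.2.2.1, h1.2.2.1, hw]

theorem BrakeInv.step_cases {c : Code} {F F' : Set Fact} (hF : BrakeInv F)
    (h : ChaseStep (simRules c) F F') :
    (∃ w, ((5, [w]) : Fact) ∈ F ∧ ExStep c F w F') ∨
    (ChaseStep (pullRule :: datalogRules c) F F' ∧ DatalogStep F F') := by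
  obtain ⟨⟨r, σ⟩, ⟨hr, hl, ho⟩, σ', hσ, rfl⟩ := h
  dsimp only at hr
  have hfresh : ∀ v, existVar r v → σ' v ∉ termsOf F := fun v hv => by
    obtain ⟨n, hn, hn'⟩ := hσ.2.1 v hv
    rwa [hn]
  rcases mem_simRules.1 hr with rfl | rfl | hr'
  · left
    have h1 := loaded_mkRule.1 hl
    simp only [List.mem_singleton, forall_eq, List.map_cons, List.map_nil] at h1
    have hw : ((4, [σ 0, σ 0]) : Fact) ∉ F := fun hw => ho (hF.obsolete_growRule hl hw)
    have e0 : σ' 0 = σ 0 := hσ.1 0 (bodyVar_mkRule.2 (by simp))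
    have e1 : σ' 1 = σ 1 := hσ.1 1 (bodyVar_mkRule.2 (by simp))
    refine ⟨σ 0, (hF.line h1).2.2, ?_⟩
    convert ExStep.grow h1 hw (hfresh 2 (existVar_mkRule.2 (by simp))) using 2
    rw [growRule, outputOf_mkRule_eq]
    ext f
    simp [e0, e1]
  · left
    have h1 := loaded_mkRule.1 hl
    simp only [List.mem_cons, List.not_mem_nil, or_false, forall_eq_or_imp, forall_eq,
      List.map_cons, List.map_nil] at h1
    have hw : ((4, [σ 0, σ 0]) : Fact) ∉ F := fun hw => ho (hF.obsolete_spawnRule hl hw)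
    have e0 : σ' 0 = σ 0 := hσ.1 0 (bodyVar_mkRule.2 (by simp))
    have e3 : σ' 3 = σ 3 := hσ.1 3 (bodyVar_mkRule.2 (by simp))
    obtain ⟨h1, h2, h3, h4, h5, h6, h7⟩ := h1
    refine ⟨σ 0, (hF.line h3).2.2, ?_⟩
    convert ExStep.spawn h1 h2 h3 h4 h5 h6 h7 hw (hfresh 7 (existVar_mkRule.2 (by simp))) using 2
    rw [spawnRule, outputOf_mkRule_eq]
    ext f
    simp [e0, e3]
  · right
    refine ⟨⟨_, ⟨hr', hl, ho⟩, σ', hσ, rfl⟩, ?_⟩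
    have hcomp : IsComputationRule r → DatalogStep F (F ∪ outputOf (r, σ) σ') := by
      rintro ⟨b, p, vs, rfl, hp, hv, hs⟩
      have e : ∀ v ∈ 0 :: vs, σ' v = σ v := fun v hv' => hσ.1 v (bodyVar_mkRule.2 (hv v hv'))
      convert DatalogStep.compute (F := F) (p := p) (w := σ 0) (l := vs.map σ) hp
        (fun val hval => hs F val σ hval (loaded_mkRule.1 hl)) using 2
      rw [outputOf_mkRule_eq]
      ext f
      have e' : vs.map σ' = vs.map σ := List.map_congr_left fun v hv => e v (by simp [hv])
      simp [e 0, e']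
    simp only [datalogRules, List.mem_cons, List.mem_append] at hr'
    rcases hr' with rfl | rfl | hr' | hr'
    · have h1 := loaded_mkRule.1 hl
      simp only [List.mem_singleton, forall_eq, List.map_cons, List.map_nil] at h1
      have e0 : σ' 0 = σ 0 := hσ.1 0 (bodyVar_mkRule.2 (by simp))
      convert DatalogStep.pull h1 using 2
      rw [pullRule, outputOf_mkRule_eq]
      ext f
      simp [e0]
    · have h1 := loaded_mkRule.1 hl
      simp only [List.mem_cons, List.not_mem_nil, or_false, forall_eq_or_imp, forall_eq,
        List.map_cons, List.map_nil] at h1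
      have e0 : σ' 0 = σ 0 := hσ.1 0 (bodyVar_mkRule.2 (by simp))
      have e1 : σ' 1 = σ 1 := hσ.1 1 (bodyVar_mkRule.2 (by simp))
      convert DatalogStep.copy h1.1 h1.2 using 2
      rw [copyRule, outputOf_mkRule_eq]
      ext f
      simp [e0, e1]
    · exact hcomp (isComputationRule_arith hr')
    · exact hcomp (isComputationRule_code c r hr')

theorem BrakeInv.step {c : Code} {F F' : Set Fact} (hF : BrakeInv F)
    (h : ChaseStep (simRules c) F F') : BrakeInv F' := by
  rcases hF.step_cases h with ⟨w, -, hs⟩ | ⟨-, hs⟩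
  · cases hs with
    | grow hx hw hy =>
      refine ⟨fun {x' w'} h => ?_, fun {w'} h => ?_⟩
      · rcases h with h | h
        · exact ⟨.inl (hF.line h).1, .inl (hF.line h).2.1, .inl (hF.line h).2.2⟩
        · simp at h
          obtain ⟨rfl, rfl⟩ := h
          simp [hF.line hx]
      · rcases h with h | h
        · exact .inl (hF.pulled h)
        · simp at h
    | spawn h1 h2 h3 h4 h5 h6 h7 hw hv =>
      refine ⟨fun {x' w'} h => ?_, fun {w'} h => ?_⟩
      · rcases h with h | h
        · exact ⟨.inl (hF.line h).1, .inl (hF.line h).2.1, .inl (hF.line h).2.2⟩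
        · simp at h
          obtain ⟨rfl, rfl⟩ := h
          simp
      · rcases h with h | h
        · exact .inl (hF.pulled h)
        · simp at h
          obtain ⟨rfl, rfl⟩ := h
          exact absurd (by simp) (notMem_of_fresh hv h3)
  · cases hs with
    | pull hw =>
      refine ⟨fun {x' w'} h => ?_, fun {w'} h => ?_⟩
      · rcases h with h | h
        · exact ⟨.inl (hF.line h).1, .inl (hF.line h).2.1, .inl (hF.line h).2.2⟩
        · simp at h
          obtain ⟨rfl, rfl⟩ := h
          simp [hw]
      · rcases h with h | h
        · exact .inl (hF.pulled h)
        · simp at h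
          simp [h]
    | copy hy hxy =>
      refine ⟨fun {x' w'} h => ?_, fun {w'} h => ?_⟩
      · rcases h with h | h
        · exact ⟨.inl (hF.line h).1, .inl (hF.line h).2.1, .inl (hF.line h).2.2⟩
        · simp at h
          obtain ⟨rfl, rfl⟩ := h
          simp [hF.line hy]
      · rcases h with h | h
        · exact .inl (hF.pulled h)
        · simp at h
    | compute hp hl =>
      refine ⟨fun {x' w'} h => ?_, fun {w'} h => ?_⟩
      · rcases h with h | h
        · exact ⟨.inl (hF.line h).1, .inl (hF.line h).2.1, .inl (hF.line h).2.2⟩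
        · obtain ⟨rfl, -⟩ := Prod.mk.inj (show (_, _) = _ from h)
          omega
      · rcases h with h | h
        · exact .inl (hF.pulled h)
        · obtain ⟨rfl, -⟩ := Prod.mk.inj (show (_, _) = _ from h)
          omega

theorem BrakeInv.reflTransGen {c : Code} {F F' : Set Fact} (hF : BrakeInv F)
    (h : Relation.ReflTransGen (ChaseStep (simRules c)) F F') : BrakeInv F' := by
  induction h with
  | refl => exact hF
  | tail _ h ih => exact ih.step h

/-! ### Soundness of the simulation -/

theorem Sem.congr {val val' : GroundTerm → ℕ} {p : ℕ} {l : List GroundTerm}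
    (h : ∀ g ∈ l, val' g = val g) (hs : Sem val p l) : Sem val' p l := by
  refine ⟨?_, ?_, ?_⟩
  · rintro hp a b rfl
    rw [h a (by simp), h b (by simp)]
    exact hs.1 hp a b rfl
  · rintro hp a b q rfl
    rw [h a (by simp), h b (by simp), h q (by simp)]
    exact hs.2.1 hp a b q rfl
  · rintro c hp x y rfl
    rw [h x (by simp), h y (by simp)]
    exact hs.2.2 c hp x y rfl

/-- `val` gives the number represented by a term, and `node` the node of a brake. Facts on the
line of a brake are only meaningful as long as the brake has not been pulled. -/
structure SoundInv (F : Set Fact) (val node : GroundTerm → ℕ) : Prop where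
  zero : ∀ {x}, ((0, [x]) : Fact) ∈ F → val x = 0
  succ : ∀ {x y}, ((1, [x, y]) : Fact) ∈ F → ((5, [y]) : Fact) ∈ F ∨ val y = val x + 1
  brake : ∀ {x y}, ((1, [x, y]) : Fact) ∈ F → ((5, [x]) : Fact) ∈ F → ((5, [y]) : Fact) ∈ F
  line : ∀ {x w}, ((2, [x, w]) : Fact) ∈ F → ((5, [x]) : Fact) ∈ F → ((4, [w, w]) : Fact) ∈ F
  node : ∀ {u w a}, ((4, [u, w]) : Fact) ∈ F → ((3, [a, u, w]) : Fact) ∈ F →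
    ((4, [w, w]) : Fact) ∈ F ∨ val a = node w
  sem : ∀ {p w l}, 6 ≤ p → ((p, w :: l) : Fact) ∈ F → ((4, [w, w]) : Fact) ∈ F ∨ Sem val p l

theorem SoundInv.soundLine {F : Set Fact} {val node : GroundTerm → ℕ} (h : SoundInv F val node)
    {w : GroundTerm} (hw : ((4, [w, w]) : Fact) ∉ F) : SoundLine F val w where
  zero := h.zero
  succ h1 h2 := (h.succ h1).resolve_left fun h5 => hw (h.line h2 h5)
  sem _ _ hp hf := (h.sem hp hf).resolve_left hw

/-- `m'` is a child of `m` in the tree explored by the rule set `simRules c`. -/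
def IsChild (c : Code) (m' m : ℕ) : Prop := ∃ n, m' + 1 ∈ eval c (Nat.pair m n)

theorem SoundInv.exStep {c : Code} {F F' : Set Fact} {w : GroundTerm}
    {val node : GroundTerm → ℕ} (hA : BrakeInv F) (h : SoundInv F val node)
    (hs : ExStep c F w F') : ∃ val' node' : GroundTerm → ℕ, (∀ g ∈ termsOf F, node' g = node g) ∧
      SoundInv F' val' node' ∧
      ((4, [w, w]) : Fact) ∉ F ∧ ∀ x, ((5, [x]) : Fact) ∈ F' →
        ((5, [x]) : Fact) ∈ F ∨ IsChild c (node' x) (node w) := by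
  cases hs with
  | @grow x y hx hw hy =>
    have hxb : ((5, [x]) : Fact) ∉ F := fun h5 => hw (h.line hx h5)
    have hwb := (hA.line hx).2.2
    have hxy : x ≠ y := fun e => notMem_of_fresh hy hx (by simp [e])
    have hyb : ((5, [y]) : Fact) ∉ F := fun e => notMem_of_fresh hy e (by simp)
    have hval : ∀ {p l}, ((p, l) : Fact) ∈ F → ∀ g ∈ l,
        Function.update val y (val x + 1) g = val g :=
      fun hf g hg => Function.update_of_ne (by rintro rfl; exact notMem_of_fresh hy hf hg) _ _
    refine ⟨Function.update val y (val x + 1), node, fun _ _ => rfl,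
      ⟨?_, ?_, ?_, ?_, ?_, ?_⟩, hw, ?_⟩
    · rintro z (hz | hz)
      · rw [hval hz z (by simp), h.zero hz]
      · simp at hz
    · rintro a b (hz | hz)
      · rw [hval hz a (by simp), hval hz b (by simp)]
        exact (h.succ hz).imp .inl id
      · simp at hz
        rcases hz with ⟨rfl, rfl⟩ | ⟨rfl, rfl⟩
        · right
          simp [hxy]
        · exact .inl (.inl hwb)
    · rintro a b hz (h5 | h5)
      · rcases hz with hz | hz
        · exact .inl (h.brake hz h5)
        · simp at hz
          rcases hz with ⟨rfl, rfl⟩ | ⟨rfl, rfl⟩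
          · exact absurd h5 hxb
          · exact absurd h5 hyb
      · simp at h5
    · rintro a b hz (h5 | h5)
      · rcases hz with hz | hz
        · exact .inl (h.line hz h5)
        · simp at hz
          obtain ⟨rfl, rfl⟩ := hz
          exact absurd h5 hyb
      · simp at h5
    · rintro u b a (h4 | h4) h3
      · rcases h3 with h3 | h3
        · rw [hval h3 a (by simp)]
          exact (h.node h4 h3).imp .inl id
        · simp at h3
          obtain ⟨rfl, rfl, rfl⟩ := h3
          exact absurd h4 hw
      · simp at h4
    · rintro p b l hp (hf | hf)
      · exact (h.sem hp hf).imp .inl fun hs => hs.congr fun g hg => hval hf g (by simp [hg])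
      · simp at hf
        omega
    · rintro z (hz | hz)
      · exact .inl hz
      · simp at hz
  | @spawn a u b n p y v h1 h2 h3 h4 h5 h6 h7 hw hv =>
    have hbb : ((5, [b]) : Fact) ∉ F := fun h5 => hw (h.line h3 h5)
    have hbv : b ≠ v := fun e => notMem_of_fresh hv h3 (by simp [e])
    have hwv : w ≠ v := fun e => notMem_of_fresh hv h3 (by simp [e])
    have hline := h.soundLine hw
    refine ⟨val, Function.update node v (val b),
      fun g hg => Function.update_of_ne (by rintro rfl; exact hv hg) _ _,
      ⟨?_, ?_, ?_, ?_, ?_, ?_⟩, hw, ?_⟩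
    · rintro z (hz | hz)
      · exact h.zero hz
      · simp at hz
    · rintro x z (hz | hz)
      · exact (h.succ hz).imp .inl id
      · simp at hz
        obtain ⟨rfl, rfl⟩ := hz
        simp
    · rintro x z (hz | hz) (hb | hb)
      · exact .inl (h.brake hz hb)
      · simp at hb
        exact absurd (by simp [hb]) (notMem_of_fresh hv hz)
      · simp at hz
        obtain ⟨rfl, rfl⟩ := hz
        simp
      · simp at hz
        obtain ⟨rfl, rfl⟩ := hz
        simp
    · rintro x z (hz | hz) (hb | hb)
      · exact .inl (h.line hz hb)
      · simp at hb
        exact absurd (by simp [hb]) (notMem_of_fresh hv hz)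
      · simp at hz
        exact absurd (hz.1 ▸ hb) hbb
      · simp at hz hb
        exact absurd (hz.1.symm.trans hb) hbv
    · rintro u' w' a' (hd | hd) (hp | hp)
      · rw [Function.update_of_ne (fun e => notMem_of_fresh hv hd (by simp [e]))]
        exact (h.node hd hp).imp .inl id
      · simp at hp
        exact absurd (by simp [show w' = v by tauto]) (notMem_of_fresh hv hd)
      · simp at hd
        exact absurd (by simp [hd]) (notMem_of_fresh hv hp)
      · simp at hp hd
        obtain ⟨rfl, rfl⟩ := hd
        right
        simp only [Function.update_self]
        rcases hp with hp | hp <;> rw [hp.1]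
    · rintro p' w' l hp' (hf | hf)
      · exact (h.sem hp' hf).imp .inl id
      · simp at hf
        omega
    · rintro z (hz | hz)
      · exact .inl hz
      · simp at hz
        subst hz
        right
        refine ⟨val n, ?_⟩
        rw [Function.update_self, ← (h.node h2 h1).resolve_left hw, hline.pair h4,
          ← hline.succ h6 h7]
        exact hline.code h5

theorem SoundInv.datalogStep {F F' : Set Fact} {val node : GroundTerm → ℕ} (hA : BrakeInv F)
    (h : SoundInv F val node) (hs : DatalogStep F F') : SoundInv F' val node ∧
      ∀ x, ((5, [x]) : Fact) ∈ F' → ((5, [x]) : Fact) ∈ F := by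
  cases hs with
  | @pull w hw =>
    have h5 : ∀ x, ((5, [x]) : Fact) ∈ F ∪ {(4, [w, w]), (2, [w, w]), (1, [w, w]), (3, [w, w, w])} →
        ((5, [x]) : Fact) ∈ F := by simp
    refine ⟨⟨?_, ?_, ?_, ?_, ?_, ?_⟩, h5⟩
    · rintro z (hz | hz)
      · exact h.zero hz
      · simp at hz
    · rintro a b (hz | hz)
      · exact (h.succ hz).imp .inl id
      · simp at hz
        exact .inl (.inl (hz.2 ▸ hw))
    · rintro a b (hz | hz) hb
      · exact .inl (h.brake hz (h5 _ hb))
      · simp at hz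
        exact .inl (hz.2 ▸ hw)
    · rintro a b (hz | hz) hb
      · exact .inl (h.line hz (h5 _ hb))
      · simp at hz
        simp [hz]
    · rintro u b a (h4 | h4) h3
      · rcases h3 with h3 | h3
        · exact (h.node h4 h3).imp .inl id
        · simp at h3
          simp [h3]
      · simp at h4
        simp [h4]
    · rintro p b l hp (hf | hf)
      · exact (h.sem hp hf).imp .inl id
      · simp at hf
        omega
  | @copy x y w hy hxy =>
    have h5 : ∀ z, ((5, [z]) : Fact) ∈ F ∪ {(2, [x, w]), (1, [x, w]), (3, [x, w, w])} →
        ((5, [z]) : Fact) ∈ F := by simp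
    have hw := (hA.line hy).2.2
    refine ⟨⟨?_, ?_, ?_, ?_, ?_, ?_⟩, h5⟩
    · rintro z (hz | hz)
      · exact h.zero hz
      · simp at hz
    · rintro a b (hz | hz)
      · exact (h.succ hz).imp .inl id
      · simp at hz
        exact .inl (.inl (hz.2 ▸ hw))
    · rintro a b (hz | hz) hb
      · exact .inl (h.brake hz (h5 _ hb))
      · simp at hz
        exact .inl (hz.2 ▸ hw)
    · rintro a b (hz | hz) hb
      · exact .inl (h.line hz (h5 _ hb))
      · simp at hz
        obtain ⟨rfl, rfl⟩ := hz
        exact .inl (h.line hy (h.brake hxy (h5 _ hb)))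
    · rintro u b a (h4 | h4) h3
      · rcases h3 with h3 | h3
        · exact (h.node h4 h3).imp .inl id
        · simp at h3
          obtain ⟨rfl, rfl, rfl⟩ := h3
          exact .inl (.inl h4)
      · simp at h4
    · rintro p b l hp (hf | hf)
      · exact (h.sem hp hf).imp .inl id
      · simp at hf
        omega
  | @compute p w l hp hl =>
    have hne : ∀ {q k}, ((q, k) : Fact) ∈ F ∪ {(p, w :: l)} → q < 6 → ((q, k) : Fact) ∈ F := by
      rintro q k (hq | hq) hlt
      · exact hq
      · simp at hq
        omega
    refine ⟨⟨?_, ?_, ?_, ?_, ?_, ?_⟩, fun x hx => hne hx (by omega)⟩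
    · exact fun hz => h.zero (hne hz (by omega))
    · exact fun hz => (h.succ (hne hz (by omega))).imp .inl id
    · exact fun hz hb => .inl (h.brake (hne hz (by omega)) (hne hb (by omega)))
    · exact fun hz hb => .inl (h.line (hne hz (by omega)) (hne hb (by omega)))
    · exact fun hz hb => (h.node (hne hz (by omega)) (hne hb (by omega))).imp .inl id
    · rintro q b k hq (hf | hf)
      · exact (h.sem hq hf).imp .inl id
      · simp at hf
        obtain ⟨rfl, rfl, rfl⟩ := hf
        by_cases hw : ((4, [b, b]) : Fact) ∈ F
        · exact .inl (.inl hw)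
        · exact .inr (hl val (h.soundLine hw))

/-! ### Well-founded trees yield terminating knowledge bases -/

/-- If elements of a growing sequence of finite sets are only added at steps in `E`, as children
(w.r.t. a relation that is well-founded below the initial labels) of an element that occurs at
finitely many steps, then `E` is finite. -/
theorem finite_of_acc {α β : Type*} {r : β → β → Prop} {B : ℕ → Set α} {node : ℕ → α → β}
    {E : Set ℕ} {W : ℕ → α} (hmono : Monotone B) (hfin : ∀ i, (B i).Finite)
    (hnode : ∀ i, ∀ x ∈ B i, node (i + 1) x = node i x) (hW : ∀ i ∈ E, W i ∈ B i)
    (hchild : ∀ i ∈ E, ∀ x ∈ B (i + 1), x ∈ B i ∨ r (node (i + 1) x) (node i (W i)))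
    (hE : ∀ i ∉ E, B (i + 1) ⊆ B i) (hWfin : ∀ i, ∀ w ∈ B i, {j ∈ E | W j = w}.Finite)
    (hacc : ∀ w ∈ B 0, Acc r (node 0 w)) : E.Finite := by
  have hnode' : ∀ {i j}, i ≤ j → ∀ x ∈ B i, node j x = node i x := by
    intro i j hij x hx
    induction j, hij using Nat.le_induction with
    | base => rfl
    | succ j hij ih => rw [hnode j x (hmono hij hx), ih]
  let child : α → α → Prop := fun w x => ∃ i ∈ E, W i = w ∧ x ∈ B (i + 1) ∧ x ∉ B i
  have key : ∀ m, Acc r m → ∀ i, ∀ w ∈ B i, node i w = m →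
      {j ∈ E | Relation.ReflTransGen child w (W j)}.Finite := by
    intro m hm
    induction hm with
    | intro m _ ih =>
      intro i w hw hwm
      have hsub : {j ∈ E | Relation.ReflTransGen child w (W j)} ⊆ {j ∈ E | W j = w} ∪
          ⋃ k ∈ {k ∈ E | W k = w}, ⋃ x ∈ B (k + 1) \ B k,
            {j ∈ E | Relation.ReflTransGen child x (W j)} := by
        rintro j ⟨hj, hwj⟩
        rcases hwj.cases_head with e | ⟨x, ⟨k, hk, hkw, hx, hx'⟩, hxj⟩
        · exact .inl ⟨hj, e.symm⟩
        · right
          simp only [Set.mem_iUnion]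
          exact ⟨k, ⟨hk, hkw⟩, x, ⟨hx, hx'⟩, hj, hxj⟩
      refine ((hWfin i w hw).union ((hWfin i w hw).biUnion fun k hk =>
        ((hfin (k + 1)).sdiff).biUnion fun x hx => ?_)).subset hsub
      refine ih (node (k + 1) x) ?_ (k + 1) x hx.1 rfl
      have h := (hchild k hk.1 x hx.1).resolve_left hx.2
      rw [hk.2] at h
      have hwk : w ∈ B k := hk.2 ▸ hW k hk.1
      have : node k w = m := by
        rw [← hwm]
        rcases le_total i k with h | h
        · exact hnode' h w hw
        · exact (hnode' h w hwk).symm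
      rwa [this] at h
  have hreach : ∀ i, ∀ x ∈ B i, ∃ w ∈ B 0, Relation.ReflTransGen child w x := by
    intro i
    induction i with
    | zero => exact fun x hx => ⟨x, hx, .refl⟩
    | succ i ih =>
      intro x hx
      by_cases hxi : x ∈ B i
      · exact ih x hxi
      · have hi : i ∈ E := by
          by_contra hi
          exact hxi (hE i hi hx)
        obtain ⟨w, hw, hwx⟩ := ih (W i) (hW i hi)
        exact ⟨w, hw, hwx.tail ⟨i, hi, rfl, hx, hxi⟩⟩
  refine ((hfin 0).biUnion fun w hw => key _ (hacc w hw) 0 w hw rfl).subset fun j hj => ?_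
  obtain ⟨w, hw, hwj⟩ := hreach j (W j) (hW j hj)
  exact Set.mem_biUnion hw ⟨hj, hwj⟩

theorem not_infinite_of_acc {c : Code} {D : Set Fact} (hD : D.Finite) (hA : BrakeInv D)
    {val₀ node₀ : GroundTerm → ℕ} (hB : SoundInv D val₀ node₀)
    (hacc : ∀ w, ((5, [w]) : Fact) ∈ D → Acc (IsChild c) (node₀ w)) :
    ¬ ∃ ch : Chase (simRules c) D, IsInfinite ch ∧ Fair ch := by
  classical
  rintro ⟨ch, hinf, hfair⟩
  have hlt : ∀ i : ℕ, (i : ℕ∞) < ch.len := fun i => by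
    rw [show ch.len = ⊤ from hinf]
    exact ENat.natCast_lt_top i
  set F := ch.fact with hF
  have hF0 : F 0 = D := ch.init
  have hstep : ∀ i, ChaseStep (simRules c) (F i) (F (i + 1)) := fun i =>
    ⟨ch.trig i, ch.activeAt i (hlt i), ch.ext i, ch.extOk i (hlt i), ch.succ i (hlt i)⟩
  have hmono : Monotone F := monotone_nat_of_le_succ fun i => (hstep i).subset
  have hfin : ∀ i, (F i).Finite := fun i => by
    induction i with
    | zero => rwa [hF0]
    | succ i ih => exact (hstep i).finite ih
  have hinv : ∀ i, BrakeInv (F i) := fun i => by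
    induction i with
    | zero => rwa [hF0]
    | succ i ih => exact ih.step (hstep i)
  let T : ℕ → Type := fun i =>
    {p : (GroundTerm → ℕ) × (GroundTerm → ℕ) // SoundInv (F i) p.1 p.2}
  have hnext : ∀ i (p : T i), ∃ q : T (i + 1),
      (∀ g ∈ termsOf (F i), q.1.2 g = p.1.2 g) ∧
      ((ChaseStep (pullRule :: datalogRules c) (F i) (F (i + 1)) ∧
        ∀ x, ((5, [x]) : Fact) ∈ F (i + 1) → ((5, [x]) : Fact) ∈ F i) ∨
      ∃ w, ((5, [w]) : Fact) ∈ F i ∧ ((4, [w, w]) : Fact) ∉ F i ∧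
        ∀ x, ((5, [x]) : Fact) ∈ F (i + 1) →
          ((5, [x]) : Fact) ∈ F i ∨ IsChild c (q.1.2 x) (p.1.2 w)) := by
    rintro i ⟨⟨val, node⟩, hp⟩
    rcases (hinv i).step_cases (hstep i) with ⟨w, hw, hs⟩ | ⟨hd, hs⟩
    · obtain ⟨val', node', h1, h2, h3, h4⟩ := hp.exStep (hinv i) hs
      exact ⟨⟨(val', node'), h2⟩, h1, .inr ⟨w, hw, h3, h4⟩⟩
    · obtain ⟨h1, h2⟩ := hp.datalogStep (hinv i) hs
      exact ⟨⟨(val, node), h1⟩, fun _ _ => rfl, .inl ⟨hd, h2⟩⟩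
  choose next hnext using hnext
  let s : ∀ i, T i := fun i => Nat.rec ⟨(val₀, node₀), by rwa [hF0]⟩ (fun i p => next i p) i
  have hs : ∀ i, s (i + 1) = next i (s i) := fun i => rfl
  have hnext' := fun i => hnext i (s i)
  simp only [← hs] at hnext'
  let E : Set ℕ := {i | ¬ (ChaseStep (pullRule :: datalogRules c) (F i) (F (i + 1)) ∧
        ∀ x, ((5, [x]) : Fact) ∈ F (i + 1) → ((5, [x]) : Fact) ∈ F i)}
  have hW : ∀ i, ∃ w, i ∈ E → ((5, [w]) : Fact) ∈ F i ∧ ((4, [w, w]) : Fact) ∉ F i ∧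
        ∀ x, ((5, [x]) : Fact) ∈ F (i + 1) →
          ((5, [x]) : Fact) ∈ F i ∨ IsChild c ((s (i + 1)).1.2 x) ((s i).1.2 w) := fun i => by
    by_cases hi : i ∈ E
    · obtain ⟨w, hw⟩ := (hnext' i).2.resolve_left hi
      exact ⟨w, fun _ => hw⟩
    · exact ⟨Sum.inl 0, fun h => absurd h hi⟩
  choose W hW using hW
  have hEfin : E.Finite := by
    refine finite_of_acc (r := IsChild c) (B := fun i => {x | ((5, [x]) : Fact) ∈ F i})
      (node := fun i => (s i).1.2) (W := W) (fun i j hij x hx => hmono hij hx) (fun i => ?_)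
      (fun i x hx => (hnext' i).1 x ⟨_, hx, by simp⟩) (fun i hi => (hW i hi).1)
      (fun i hi => (hW i hi).2.2) (fun i hi => (not_not.1 hi).2) (fun i w hw => ?_) ?_
    · exact (finite_termsOf (hfin i)).subset fun x hx => ⟨_, hx, by simp⟩
    · obtain ⟨k, -, hk⟩ := hfair (pullRule, fun _ => w) (mem_simRules.2 (by simp)) i
        (loaded_mkRule.2 (by simpa using hw))
      have hk : ((4, [w, w]) : Fact) ∈ F k := by
        obtain ⟨σ', h1, h2⟩ := obsolete_mkRule.1 hk
        have e : σ' 0 = w := h1 (5, [0]) (by simp) 0 (by simp)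
        simpa [e] using h2 (4, [0, 0]) (by simp)
      refine (Set.finite_Iio k).subset ?_
      rintro j ⟨hj, rfl⟩
      by_contra hjk
      exact (hW j hj).2.1 (hmono (not_lt.1 hjk) hk)
    · intro w hw
      rw [Set.mem_ofPred_eq, hF0] at hw
      exact hacc w hw
  obtain ⟨K, hK⟩ := hEfin.bddAbove
  refine not_forall_datalog_step (S := pullRule :: datalogRules c) (F := fun i => F (K + 1 + i))
    ?_ (hfin _) fun i => ?_
  · rintro r hr
    rcases List.mem_cons.1 hr with rfl | hr
    · exact isDatalog_pullRule
    · exact isDatalog_of_mem_datalogRules r hr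
  · by_contra h
    have : K + 1 + i ∈ E := fun h' => h h'.1
    have := hK this
    omega

/-! ### Ill-founded trees yield infinite fair derivations -/

theorem exists_path_of_transGen {α : Type*} {R : α → α → Prop} {a b : α}
    (h : Relation.TransGen R a b) :
    ∃ (n : ℕ) (p : ℕ → α), p 0 = a ∧ p (n + 1) = b ∧ ∀ i ≤ n, R (p i) (p (i + 1)) := by
  induction h with
  | @single b h => exact ⟨0, fun i => if i = 0 then a else b, by simp, by simp, by simpa using h⟩
  | @tail b d _ h ih =>
    obtain ⟨n, p, h0, hn, hp⟩ := ih
    refine ⟨n + 1, fun i => if i ≤ n + 1 then p i else d, by simpa using h0, by simp, ?_⟩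
    intro i hi
    rcases Nat.lt_or_ge i (n + 1) with hin | hin
    · simpa [show i ≤ n + 1 by omega, show i ≤ n by omega] using hp i (by omega)
    · obtain rfl : i = n + 1 := by omega
      simpa [hn] using h

/-- Concatenation of non-trivial paths. -/
theorem exists_seq_of_transGen {α : Type*} {R : α → α → Prop} {G : ℕ → α}
    (h : ∀ k, Relation.TransGen R (G k) (G (k + 1))) :
    ∃ s : ℕ → α, s 0 = G 0 ∧ (∀ i, R (s i) (s (i + 1))) ∧ ∀ k, ∃ i, k ≤ i ∧ s i = G k := by
  choose n p h0 hn hp using fun k => exists_path_of_transGen (h k)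
  let next : ℕ × ℕ → ℕ × ℕ := fun q => if q.2 < n q.1 then (q.1, q.2 + 1) else (q.1 + 1, 0)
  let st : ℕ → ℕ × ℕ := fun i => next^[i] (0, 0)
  have hst : ∀ i, st (i + 1) = next (st i) := fun i => Function.iterate_succ_apply' _ _ _
  have hle : ∀ i, (st i).2 ≤ n (st i).1 := by
    intro i
    induction i with
    | zero => exact Nat.zero_le _
    | succ i ih =>
      rw [hst]
      by_cases hlt : (st i).2 < n (st i).1
      · simp only [next, hlt, if_true]
        omega
      · simp [next, hlt]
  have hreach : ∀ k, ∃ i, k ≤ i ∧ st i = (k, 0) := by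
    intro k
    induction k with
    | zero => exact ⟨0, le_rfl, rfl⟩
    | succ k ih =>
      obtain ⟨i, hki, hi⟩ := ih
      have hj : ∀ j ≤ n k, st (i + j) = (k, j) := by
        intro j
        induction j with
        | zero => exact fun _ => hi
        | succ j ihj =>
          intro hj
          rw [← Nat.add_assoc, hst, ihj (by omega)]
          simp [next, Nat.lt_of_succ_le hj]
      refine ⟨i + n k + 1, by omega, ?_⟩
      rw [hst, hj _ le_rfl]
      simp [next]
  refine ⟨fun i => p (st i).1 (st i).2, h0 0, fun i => ?_, fun k => ?_⟩
  · have hR := hp (st i).1 (st i).2 (hle i)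
    by_cases hlt : (st i).2 < n (st i).1
    · simpa only [hst, next, hlt, if_true] using hR
    · have he : (st i).2 = n (st i).1 := le_antisymm (hle i) (not_lt.1 hlt)
      simp only [hst, next, hlt, if_false]
      rw [h0, ← hn (st i).1, ← he]
      exact hR
  · obtain ⟨i, hki, hi⟩ := hreach k
    exact ⟨i, hki, by simp only [hi, h0]⟩

theorem ClosedUnder.obsolete {S : RuleSet} {F : Set Fact} (h : ClosedUnder S F) {t : Trigger}
    (ht : t.1 ∈ S) (hl : loaded t F) : obsolete t F :=
  ⟨t.2, fun _ _ => rfl, h t.1 ht t.2 hl⟩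

theorem fst_ne_of_mem {c : Code} : ∀ r ∈ growRule :: datalogRules c, ∀ a ∈ r.2,
    a.1 ≠ 4 ∧ a.1 ≠ 5 := by
  have hcomp : ∀ r, IsComputationRule r → ∀ a ∈ r.2, a.1 ≠ 4 ∧ a.1 ≠ 5 := by
    rintro r ⟨b, p, vs, rfl, hp, -, -⟩ a ha
    simp only [mkRule, List.map_cons, List.map_nil, List.mem_singleton, varAtom] at ha
    subst ha
    exact ⟨by dsimp only; omega, by dsimp only; omega⟩
  simp only [datalogRules, List.mem_cons, List.mem_append]
  rintro r (rfl | rfl | hr | hr)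
  · simp [growRule, mkRule, varAtom]
  · simp [copyRule, mkRule, varAtom]
  · exact hcomp r (isComputationRule_arith hr)
  · exact hcomp r (isComputationRule_code c r hr)

/-- Steps with `growRule` and the computation rules neither create nor pull brakes. -/
theorem mem_of_reflTransGen {c : Code} {F F' : Set Fact}
    (h : Relation.ReflTransGen (ChaseStep (growRule :: datalogRules c)) F F') {f : Fact}
    (hf : f ∈ F') (hf' : f.1 = 4 ∨ f.1 = 5) : f ∈ F := by
  induction h with
  | refl => exact hf
  | tail _ h ih =>
    obtain ⟨t, ⟨ht, -⟩, σ', -, rfl⟩ := h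
    rcases hf with hf | ⟨a, ha, rfl⟩
    · exact ih hf
    · have := fst_ne_of_mem t.1 ht a ha
      simp only [applyA] at hf'
      omega

theorem finite_of_reflTransGen {S : RuleSet} {F F' : Set Fact}
    (h : Relation.ReflTransGen (ChaseStep S) F F') (hF : F.Finite) : F'.Finite := by
  induction h with
  | refl => exact hF
  | tail _ h ih => exact h.finite ih

theorem exists_grown_line {c : Code} {F : Set Fact} (hF : F.Finite) {w : GroundTerm}
    {e : ℕ → GroundTerm} {m : ℕ}
    (hs : ∀ n < m, ((1, [e n, e (n + 1)]) : Fact) ∈ F) (hm : ((2, [e m, w]) : Fact) ∈ F)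
    (k : ℕ) : ∃ (F' : Set Fact) (e' : ℕ → GroundTerm),
      Relation.ReflTransGen (ChaseStep (growRule :: datalogRules c)) F F' ∧
      (∀ n ≤ m, e' n = e n) ∧ (∀ n < m + k, ((1, [e' n, e' (n + 1)]) : Fact) ∈ F') ∧
      ((2, [e' (m + k), w]) : Fact) ∈ F' := by
  induction k with
  | zero => exact ⟨F, e, .refl, fun _ _ => rfl, hs, hm⟩
  | succ k ih =>
    obtain ⟨F₁, e₁, hr, he, hs₁, hm₁⟩ := ih
    obtain ⟨F₂, hr₂, ho⟩ := exists_reflTransGen_obsolete (S := growRule :: datalogRules c)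
      (finite_of_reflTransGen hr hF) (t := (growRule, fun i => if i = 0 then w else e₁ (m + k)))
      List.mem_cons_self (loaded_mkRule.2 (by simpa using hm₁))
    obtain ⟨σ', hσ, ho⟩ := obsolete_mkRule.1 ho
    have e0 : σ' 0 = w := hσ (2, [1, 0]) (by simp) 0 (by simp)
    have e1 : σ' 1 = e₁ (m + k) := hσ (2, [1, 0]) (by simp) 1 (by simp)
    have hsucc := ho (1, [1, 2]) (by simp)
    have hline := ho (2, [2, 0]) (by simp)
    simp only [List.map_cons, List.map_nil, e0, e1] at hsucc hline
    refine ⟨F₂, Function.update e₁ (m + k + 1) (σ' 2), hr.trans hr₂, fun n hn => ?_,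
      fun n hn => ?_, ?_⟩
    · rw [Function.update_of_ne (by omega), he n hn]
    · rw [Function.update_of_ne (by omega)]
      rcases Nat.lt_succ_iff_lt_or_eq.1 (show n < m + k + 1 from hn) with hn | rfl
      · rw [Function.update_of_ne (by omega)]
        exact subset_of_reflTransGen hr₂ (hs₁ n hn)
      · rwa [Function.update_self]
    · rwa [← Nat.add_assoc, Function.update_self]

theorem ChainIn.of_closedUnder {c : Code} {F : Set Fact} (hF : ClosedUnder (datalogRules c) F)
    {w : GroundTerm} {e : ℕ → GroundTerm} {N : ℕ} (h0 : ((0, [e 0]) : Fact) ∈ F)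
    (hs : ∀ n < N, ((1, [e n, e (n + 1)]) : Fact) ∈ F) (hN : ((2, [e N, w]) : Fact) ∈ F) :
    ChainIn F w e N := by
  refine ⟨h0, fun n hn => ?_, hs⟩
  induction hn using Nat.decreasingInduction with
  | self => exact hN
  | of_succ n hn ih =>
    simpa using hF.mem (b := [(2, [2, 0]), (1, [1, 2])])
      (hd := [(2, [1, 0]), (1, [1, 0]), (3, [1, 0, 0])]) List.mem_cons_self [w, e n, e (n + 1)]
      (by simp [ih, hs n hn]) (2, [1, 0]) (by simp)

/-- `F` contains exactly one brake that has not been pulled; it is at the node `m` and has no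
children yet. -/
structure Stage (m : ℕ) (F : Set Fact) : Prop where
  finite : F.Finite
  inv : BrakeInv F
  brake : ∃ (w u : GroundTerm) (e : ℕ → GroundTerm), ((0, [e 0]) : Fact) ∈ F ∧
    (∀ n < m, ((1, [e n, e (n + 1)]) : Fact) ∈ F) ∧ ((2, [e m, w]) : Fact) ∈ F ∧
    ((3, [e m, u, w]) : Fact) ∈ F ∧ ((4, [u, w]) : Fact) ∈ F ∧
    (∀ v, ((4, [w, v]) : Fact) ∉ F) ∧
    ∀ w', ((5, [w']) : Fact) ∈ F → w' = w ∨ ((4, [w', w']) : Fact) ∈ F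

theorem Stage.exists_next {c : Code} {m m' : ℕ} (hm : IsChild c m' m) {F : Set Fact}
    (hF : Stage m F) : ∃ F', Stage m' F' ∧ Relation.TransGen (ChaseStep (simRules c)) F F' ∧
      ClosedUnder (datalogRules c) F' ∧
      ∀ w, ((5, [w]) : Fact) ∈ F → ((4, [w, w]) : Fact) ∈ F' := by
  obtain ⟨n, hn⟩ := hm
  obtain ⟨N₀, hN₀⟩ := derivable_of_mem_eval c _ _ hn
  obtain ⟨hfin, hinv, w, u, e, h0, hs, hline, hP, hD, hw, hbr⟩ := hF
  have hS₁ : growRule :: datalogRules c ⊆ simRules c := by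
    intro r hr
    rcases List.mem_cons.1 hr with rfl | hr
    · exact mem_simRules.2 (.inl rfl)
    · exact mem_simRules.2 (.inr (.inr (List.mem_cons_of_mem _ hr)))
  have hS₂ : datalogRules c ⊆ growRule :: datalogRules c := List.subset_cons_self _ _
  have hlift : ∀ {S : RuleSet}, S ⊆ simRules c → ∀ {A B : Set Fact},
      Relation.ReflTransGen (ChaseStep S) A B →
      Relation.ReflTransGen (ChaseStep (simRules c)) A B :=
    fun hS _ _ h => h.lift id fun _ _ h => h.mono hS
  -- extend and saturate the line of `w`
  set k := N₀ + Nat.pair m n + n + m' + 1 with hk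
  obtain ⟨F₁, e₁, hr₁, he₁, hs₁, hm₁⟩ := exists_grown_line (c := c) hfin hs hline k
  obtain ⟨F₂, hr₂, hcl₂⟩ := exists_closedUnder (isDatalog_of_mem_datalogRules (c := c))
    (finite_of_reflTransGen hr₁ hfin)
  have hr₁₂ : Relation.ReflTransGen (ChaseStep (growRule :: datalogRules c)) F F₂ :=
    hr₁.trans (hr₂.lift id fun _ _ h => h.mono hS₂)
  have hsub₂ := subset_of_reflTransGen hr₁₂
  have hfin₂ := finite_of_reflTransGen hr₁₂ hfin
  have hinv₂ := hinv.reflTransGen (hlift hS₁ hr₁₂)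
  have hsub₁₂ := subset_of_reflTransGen hr₂
  have hch : ChainIn F₂ w e₁ (m + k) := .of_closedUnder hcl₂
    (hsub₂ (by rwa [he₁ 0 (Nat.zero_le _)])) (fun n hn => hsub₁₂ (hs₁ n hn)) (hsub₁₂ hm₁)
  have hcl : ClosedUnder (arithRules ++ codeRules c) F₂ :=
    hcl₂.mono (List.subset_cons_self _ _)
  have hw₂ : ∀ v, ((4, [w, v]) : Fact) ∉ F₂ := fun v h =>
    hw v (mem_of_reflTransGen hr₁₂ h (.inl rfl))
  -- create a new brake
  let σ : ℕ → GroundTerm := fun i => [w, e₁ m, u, e₁ m', e₁ n, e₁ (Nat.pair m n),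
    e₁ (m' + 1)].getD i w
  have hload : loaded (spawnRule (codePred c), σ) F₂ := by
    refine loaded_mkRule.2 ?_
    have hpair := hch.pair (hcl₂.mono fun r hr => by simp [datalogRules, hr]) (a := m) (b := n)
      (by omega)
    have heval := hN₀ F₂ w e₁ (m + k) hcl hch (by omega)
    have hP₂ := hsub₂ hP
    rw [← he₁ m le_rfl] at hP₂
    simp [σ, hP₂, hsub₂ hD, hpair, heval, hch.line m' (by omega), hch.succ m' (by omega),
      hch.line (m' + 1) (by omega)]
  have hact : Active (simRules c) F₂ (spawnRule (codePred c), σ) := by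
    refine ⟨mem_simRules.2 (.inr (.inl rfl)), hload, fun ho => ?_⟩
    obtain ⟨τ, hτ, ho⟩ := obsolete_mkRule.1 ho
    have e0 : τ 0 = w := hτ (2, [3, 0]) (by simp) 0 (by simp)
    exact hw₂ (τ 7) (by simpa [e0] using ho (4, [0, 7]) (by simp))
  obtain ⟨τ, hτ⟩ := exists_properExt hfin₂ (spawnRule (codePred c), σ)
  have e0 : τ 0 = w := hτ.1 0 (bodyVar_mkRule.2 (by simp))
  have e3 : τ 3 = e₁ m' := hτ.1 3 (bodyVar_mkRule.2 (by simp))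
  set v := τ 7 with hv
  have hvF : v ∉ termsOf F₂ := by
    obtain ⟨l, hl, hl'⟩ := hτ.2.1 7 (existVar_mkRule.2 (by simp))
    rwa [hv, hl]
  have hvw : v ≠ w := by
    rintro rfl
    exact notMem_of_fresh hvF (hch.line 0 (Nat.zero_le _)) (by simp)
  set F₃ := F₂ ∪ outputOf (spawnRule (codePred c), σ) τ with hF₃
  have hstep₃ : ChaseStep (simRules c) F₂ F₃ := ⟨_, hact, τ, hτ, rfl⟩
  have hout : outputOf (spawnRule (codePred c), σ) τ = {f | f ∈ ([(3, [e₁ m', w, v]), (4, [w, v]),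
      (2, [e₁ m', v]), (1, [e₁ m', v]), (3, [e₁ m', v, v]), (5, [v])] : List Fact)} := by
    rw [spawnRule, outputOf_mkRule_eq]
    simp [e0, e3, hv]
  have hww₃ : ((4, [w, w]) : Fact) ∉ F₃ := by
    rw [hF₃, hout]
    simpa [hvw.symm] using hw₂ w
  have hv₃ : ∀ x, ((4, [v, x]) : Fact) ∉ F₃ := by
    intro x
    rw [hF₃, hout]
    simpa [hvw] using fun h => notMem_of_fresh hvF h (by simp)
  have hbr₃ : ∀ x, ((5, [x]) : Fact) ∈ F₃ → x = v ∨ ((5, [x]) : Fact) ∈ F := by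
    rw [hF₃, hout]
    rintro x (h | h)
    · exact .inr (mem_of_reflTransGen hr₁₂ h (.inr rfl))
    · exact .inl (by simpa using h)
  have hfin₃ := hstep₃.finite hfin₂
  -- pull the old brake
  have hact₄ : Active (simRules c) F₃ (pullRule, fun _ => w) := by
    refine ⟨mem_simRules.2 (by simp), loaded_mkRule.2 ?_, fun ho => ?_⟩
    · simpa using hstep₃.subset (hsub₂ (hinv.line hline).2.2)
    · obtain ⟨τ, hτ, ho⟩ := obsolete_mkRule.1 ho
      have e0 : τ 0 = w := hτ (5, [0]) (by simp) 0 (by simp)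
      exact hww₃ (by simpa [e0] using ho (4, [0, 0]) (by simp))
  obtain ⟨τ₄, hτ₄⟩ := exists_properExt hfin₃ (pullRule, fun _ => w)
  have e0₄ : τ₄ 0 = w := hτ₄.1 0 (bodyVar_mkRule.2 (by simp))
  set F₄ := F₃ ∪ outputOf (pullRule, fun _ => w) τ₄ with hF₄
  have hstep₄ : ChaseStep (simRules c) F₃ F₄ := ⟨_, hact₄, τ₄, hτ₄, rfl⟩
  have hout₄ : outputOf (pullRule, fun _ => w) τ₄ =
      {f | f ∈ ([(4, [w, w]), (2, [w, w]), (1, [w, w]), (3, [w, w, w])] : List Fact)} := by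
    rw [pullRule, outputOf_mkRule_eq]
    simp [e0₄]
  -- saturate
  obtain ⟨F₅, hr₅, hcl₅⟩ := exists_closedUnder (isDatalog_of_mem_datalogRules (c := c))
    (hstep₄.finite hfin₃)
  have hr₅' : Relation.ReflTransGen (ChaseStep (growRule :: datalogRules c)) F₄ F₅ :=
    hr₅.lift id fun _ _ h => h.mono hS₂
  have htrans : Relation.TransGen (ChaseStep (simRules c)) F F₅ :=
    (Relation.TransGen.tail' (hlift hS₁ hr₁₂) hstep₃).tail hstep₄ |>.trans_left (hlift hS₁ hr₅')
  have hsub₅ := subset_of_reflTransGen hr₅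
  have hsub₃₅ : F₃ ⊆ F₅ := hstep₄.subset.trans hsub₅
  have hsub₂₅ : F₂ ⊆ F₅ := hstep₃.subset.trans hsub₃₅
  have hww₅ : ((4, [w, w]) : Fact) ∈ F₅ := hsub₅ (by rw [hF₄, hout₄]; simp)
  have hpull : ∀ w, ((5, [w]) : Fact) ∈ F → ((4, [w, w]) : Fact) ∈ F₅ := fun w' hw' => by
    rcases hbr w' hw' with rfl | h
    · exact hww₅
    · exact hsub₂₅ (hsub₂ h)
  have hnew : outputOf (spawnRule (codePred c), σ) τ ⊆ F₅ := Set.subset_union_right.trans hsub₃₅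
  rw [hout] at hnew
  refine ⟨F₅, ⟨finite_of_reflTransGen hr₅ (hstep₄.finite hfin₃),
    hinv.reflTransGen htrans.to_reflTransGen, v, w, e₁, hsub₂₅ hch.zero,
    fun n hn => hsub₂₅ (hch.succ n (by omega)), hnew (by simp), hnew (by simp), hnew (by simp),
    fun x hx => ?_, fun x hx => ?_⟩, htrans, hcl₅, hpull⟩
  · have hx := mem_of_reflTransGen hr₅' hx (.inl rfl)
    rw [hF₄, hout₄] at hx
    rcases hx with hx | hx
    · exact hv₃ x hx
    · simp [hvw] at hx
  · have hx := mem_of_reflTransGen hr₅' hx (.inr rfl)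
    rw [hF₄, hout₄] at hx
    rcases hx with hx | hx
    · exact (hbr₃ x hx).imp id (hpull x)
    · simp at hx

theorem exists_infinite_of_not_acc {c : Code} {m : ℕ} {D : Set Fact} (hD : Stage m D)
    (hacc : ¬ Acc (IsChild c) m) : ∃ ch : Chase (simRules c) D, IsInfinite ch ∧ Fair ch := by
  obtain ⟨f, hf0, hf⟩ := not_acc_iff_exists_descending_chain.1 hacc
  choose next hstage htrans hclosed hpull using
    fun k (F : {F // Stage (f k) F}) => F.2.exists_next (hf k)
  let s : ∀ k, {F // Stage (f k) F} := fun k =>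
    Nat.rec ⟨D, hf0 ▸ hD⟩ (fun k F => ⟨next k F, hstage k F⟩) k
  obtain ⟨F, hF0, hstep, hreach⟩ := exists_seq_of_transGen (R := ChaseStep (simRules c))
    (G := fun k => (s k).1) fun k => htrans k (s k)
  choose trig hact ext hext hsucc using hstep
  have hmono : Monotone F := monotone_nat_of_le_succ fun i => by
    rw [hsucc]
    exact Set.subset_union_left
  refine ⟨⟨⊤, F, trig, ext, hF0, fun i _ => hact i, fun i _ => hext i, fun i _ => hsucc i,
    fun i h => absurd (ENat.natCast_lt_top i) h⟩, rfl, ?_⟩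
  intro t ht i hl
  obtain ⟨i₁, hi₁, hG⟩ := hreach i
  obtain ⟨j, hj, hG'⟩ := hreach (i + 1)
  refine ⟨j, by omega, ?_⟩
  have hl : loaded t (F i) := hl
  have hl₁ : loaded t (s i).1 := hG ▸ hl.mono (hmono hi₁)
  have hsub : (s i).1 ⊆ (s (i + 1)).1 := subset_of_reflTransGen (htrans i (s i)).to_reflTransGen
  have hl₂ := hl₁.mono hsub
  change obsolete t (F j)
  rw [hG']
  have hinv := (s (i + 1)).2.inv
  obtain ⟨r, σ⟩ := t
  rcases mem_simRules.1 ht with rfl | rfl | hr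
  · refine hinv.obsolete_growRule hl₂ (hpull i (s i) _ ?_)
    have h1 := loaded_mkRule.1 hl₁ (2, [1, 0]) (by simp)
    exact ((s i).2.inv.line h1).2.2
  · refine hinv.obsolete_spawnRule hl₂ (hpull i (s i) _ ?_)
    have h1 := loaded_mkRule.1 hl₁ (2, [3, 0]) (by simp)
    exact ((s i).2.inv.line h1).2.2
  · rcases List.mem_cons.1 hr with rfl | hr
    · have h1 := hpull i (s i) _ (loaded_mkRule.1 hl₁ (5, [0]) (by simp))
      have h2 := hinv.pulled h1
      refine obsolete_mkRule.2 ⟨σ, fun _ _ _ _ => rfl, ?_⟩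
      have h1' : ((4, [σ 0, σ 0]) : Fact) ∈ (s (i + 1)).1 := h1
      simp [h1', h2, hinv.line h2]
    · exact (hclosed i (s i)).obsolete hr hl₂

/-! ### The reduction -/

/-- The number line up to `r` together with a brake at the node `r`. -/
def rootDb (r : ℕ) : Database :=
  (List.range r).map (fun i => ((1, [Sum.inl (i + 2), Sum.inl (i + 3)]) : Fact)) ++
    [(0, [Sum.inl 2]), (2, [Sum.inl (r + 2), Sum.inl 0]), (1, [Sum.inl (r + 2), Sum.inl 0]),
      (3, [Sum.inl (r + 2), Sum.inl 1, Sum.inl 0]), (3, [Sum.inl (r + 2), Sum.inl 0, Sum.inl 0]),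
      (4, [Sum.inl 1, Sum.inl 0]), (5, [Sum.inl 0])]

theorem mem_rootDb {r : ℕ} {f : Fact} : f ∈ dbSet (rootDb r) ↔
    (∃ i < r, ((1, [Sum.inl (i + 2), Sum.inl (i + 3)]) : Fact) = f) ∨ f = (0, [Sum.inl 2]) ∨
    f = (2, [Sum.inl (r + 2), Sum.inl 0]) ∨ f = (1, [Sum.inl (r + 2), Sum.inl 0]) ∨
    f = (3, [Sum.inl (r + 2), Sum.inl 1, Sum.inl 0]) ∨
    f = (3, [Sum.inl (r + 2), Sum.inl 0, Sum.inl 0]) ∨ f = (4, [Sum.inl 1, Sum.inl 0]) ∨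
    f = (5, [Sum.inl 0]) := by
  simp [dbSet, rootDb]

theorem isRule_of_mem_simRules {c : Code} : IsRuleSet (simRules c) := by
  have hcomp : ∀ {r}, IsComputationRule r → IsRule r := by
    rintro r ⟨b, p, vs, rfl, -⟩
    exact isRule_mkRule (by simp)
  intro r hr
  simp only [simRules, datalogRules, List.mem_cons, List.mem_append] at hr
  rcases hr with rfl | rfl | rfl | rfl | hr | hr
  · exact isRule_mkRule (by simp)
  · exact isRule_mkRule (by simp)
  · exact isRule_mkRule (by simp)
  · exact isRule_mkRule (by simp)
  · exact hcomp (isComputationRule_arith hr)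
  · exact hcomp (isComputationRule_code c r hr)

theorem isDatabase_rootDb (r : ℕ) : IsDatabase (rootDb r) := by
  intro f hf t ht n
  rcases mem_rootDb.1 hf with ⟨i, -, rfl⟩ | rfl | rfl | rfl | rfl | rfl | rfl | rfl <;>
    simp at ht <;> grind

theorem brakeInv_rootDb (r : ℕ) : BrakeInv (dbSet (rootDb r)) where
  line := by
    intro x w h
    simp [mem_rootDb] at h ⊢
    simp [h]
  pulled := by simp [mem_rootDb]

theorem soundInv_rootDb (r : ℕ) :
    SoundInv (dbSet (rootDb r)) (Sum.elim (fun n => n - 2) fun _ => 0) fun _ => r where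
  zero := by simp +contextual [mem_rootDb]
  succ := by
    intro x y h
    simp [mem_rootDb] at h ⊢
    rcases h with ⟨i, -, rfl, rfl⟩ | ⟨rfl, rfl⟩ <;> simp
  brake := by
    intro x y h
    simp [mem_rootDb] at h ⊢
    rcases h with ⟨i, -, rfl, rfl⟩ | ⟨rfl, rfl⟩ <;> simp
  line := by
    intro x w h
    simp [mem_rootDb] at h ⊢
    simp [h]
  node := by
    intro u w a h h'
    simp [mem_rootDb] at h h' ⊢
    rcases h' with ⟨rfl, -⟩ | ⟨rfl, -⟩ <;> simp
  sem := by
    intro p w l hp h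
    simp [mem_rootDb] at h
    omega

theorem stage_rootDb (r : ℕ) : Stage r (dbSet (rootDb r)) where
  finite := List.finite_toSet _
  inv := brakeInv_rootDb r
  brake := by
    refine ⟨Sum.inl 0, Sum.inl 1, fun i => Sum.inl (i + 2), ?_⟩
    simp [mem_rootDb]

theorem tkrAll_iff_acc (c : Code) (r : ℕ) :
    TKRall (simRules c, rootDb r) ↔ Acc (IsChild c) r := by
  refine ⟨fun h => ?_, fun h => ⟨⟨isRule_of_mem_simRules, isDatabase_rootDb r⟩, ?_⟩⟩
  · by_contra hacc
    exact h.2 (exists_infinite_of_not_acc (stage_rootDb r) hacc)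
  · exact not_infinite_of_acc (stage_rootDb r).finite (brakeInv_rootDb r) (soundInv_rootDb r)
      fun _ _ => h

theorem primrec_rootDb : Primrec rootDb := by
  have hl : ∀ k, Primrec fun i : ℕ => (Sum.inl (i + k) : GroundTerm) := fun k =>
    Primrec.sumInl.comp (Primrec.nat_add.comp .id (.const k))
  have hc : ∀ (p : ℕ) {f : ℕ → List GroundTerm}, Primrec f →
      Primrec fun r => ((p, f r) : Fact) := fun p _ hf => (Primrec.const p).pair hf
  have hcons : ∀ {α : Type} [Primcodable α] {f : ℕ → α} {g : ℕ → List α}, Primrec f → Primrec g →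
      Primrec fun r => f r :: g r := fun hf hg => Primrec.list_cons.comp hf hg
  refine Primrec.list_append.comp (Primrec.list_map Primrec.list_range ?_) ?_
  · exact ((hc 1 (hcons (hl 2) (hcons (hl 3) (.const [])))).comp Primrec.snd).to₂
  · exact hcons (.const _) <| hcons (hc 2 (hcons (hl 2) (.const _))) <|
      hcons (hc 1 (hcons (hl 2) (.const _))) <| hcons (hc 3 (hcons (hl 2) (.const _))) <|
      hcons (hc 3 (hcons (hl 2) (.const _))) (.const _)

/-- The child relation of the tree of all pairs `(a, s)` such that no proper prefix of `s`
satisfies `R a`. -/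
theorem exists_code_isChild_iff {R : ℕ → List ℕ → Bool} (hR : Computable₂ R) :
    ∃ c : Code, ∀ (a : ℕ) (s : List ℕ) (m : ℕ), IsChild c m (Encodable.encode (a, s)) ↔
      R a s = false ∧ ∃ n, m = Encodable.encode (a, s ++ [n]) := by
  let d : ℕ → ℕ × List ℕ := fun k => (Encodable.decode k.unpair.1).getD (0, [])
  let h : ℕ → ℕ := fun k => bif R (d k).1 (d k).2 then 0 else
    Encodable.encode ((d k).1, (d k).2 ++ [k.unpair.2]) + 1
  have hd : Primrec d := Primrec.option_getD.comp
    (Primrec.decode.comp (Primrec.fst.comp Primrec.unpair)) (.const _)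
  have hh : Computable h := by
    refine Computable.cond (hR.comp (Primrec.fst.comp hd).to_comp (Primrec.snd.comp hd).to_comp)
      (.const 0) (Primrec.to_comp ?_)
    exact Primrec.succ.comp (Primrec.encode.comp ((Primrec.fst.comp hd).pair
      (Primrec.list_append.comp (Primrec.snd.comp hd)
        (Primrec.list_cons.comp (Primrec.snd.comp Primrec.unpair) (.const [])))))
  obtain ⟨c, hc⟩ := Nat.Partrec.Code.exists_code.1 (Partrec.nat_iff.1 hh)
  refine ⟨c, fun a s m => ?_⟩
  have hdk : ∀ n, d (Nat.pair (Encodable.encode (a, s)) n) = (a, s) := fun n => by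
    simp only [d, Nat.unpair_pair, Encodable.encodek, Option.getD_some]
  simp only [IsChild, hc, PFun.coe_val, Part.mem_some_iff, h, hdk, Nat.unpair_pair]
  cases R a s <;> simp

/-- Infinite branches of the tree of all `s` that have no proper prefix satisfying `R a`. -/
theorem not_acc_iff_exists_branch {r : ℕ → ℕ → Prop} {P : List ℕ → Bool} {node : List ℕ → ℕ}
    (hr : ∀ s m, r m (node s) ↔ P s = false ∧ ∃ n, m = node (s ++ [n])) :
    ¬ Acc r (node []) ↔ ∃ f : ℕ → ℕ, ∀ k, P ((List.range k).map f) = false := by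
  rw [not_acc_iff_exists_descending_chain]
  constructor
  · rintro ⟨g, h0, hg⟩
    have hnext : ∀ s k, node s = g k → P s = false ∧ ∃ n, g (k + 1) = node (s ++ [n]) :=
      fun s k h => (hr s _).1 (h ▸ hg k)
    choose! next hnext using fun s k h => (hnext s k h).2
    let f : ℕ → List ℕ := fun k => Nat.rec [] (fun k s => s ++ [next s k]) k
    have hf : ∀ k, node (f k) = g k := by
      intro k
      induction k with
      | zero => exact h0.symm
      | succ k ih => exact (hnext _ k ih).symm
    have hmap : ∀ k, (List.range k).map (fun k => next (f k) k) = f k := by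
      intro k
      induction k with
      | zero => rfl
      | succ k ih => rw [List.range_succ, List.map_append, ih]; rfl
    exact ⟨_, fun k => by rw [hmap]; exact (hr _ _).1 (hf k ▸ hg k) |>.1⟩
  · rintro ⟨f, hf⟩
    exact ⟨fun k => node ((List.range k).map f), rfl, fun k => (hr _ _).2
      ⟨hf k, f k, by simp [List.range_succ]⟩⟩

end ChaseTermination

namespace ChaseTermination

/-- The class `TKR∀` is `Π¹₁`-hard: every `Π¹₁` problem many-one reduces to
membership in `TKR∀`. -/
theorem TKRall_Pi11Hard : Pi11Hard TKRall := by
  rintro q ⟨R, hR, hq⟩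
  obtain ⟨c, hc⟩ := exists_code_isChild_iff hR
  refine ⟨fun a => (simRules c, rootDb (Encodable.encode (a, ([] : List ℕ)))), ?_, fun a => ?_⟩
  · exact ((Primrec.const _).pair (primrec_rootDb.comp
      (Primrec.encode.comp (Primrec.id.pair (.const []))))).to_comp
  · rw [hq, tkrAll_iff_acc, ← not_iff_not,
      not_acc_iff_exists_branch (node := fun s => Encodable.encode (a, s)) (hc a)]
    simp

end ChaseTermination
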